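/- Let c be a code word of C_1(2,q) with q = p^h, p prime, and q ∉ {8,9,16,25,27,49}. Then: (1) if wt(c) ≤ 3q−4, then c is a linear combination of incidence vectors of at most two lines; (2) if wt(c) ≤ 3q+1 and q = 121, then c is a linear combination of incidence vectors of at most three lines; (3) if wt(c) ≤ max{3q+1, 4q−22} and q > 17, q ≠ 121, then c is a linear combination of incidence vectors of at most three lines or c is a code word d as in the T^odd construction. -/

import Mathlib

open scoped Classical

noncomputable section

namespace PGCode

open Projectivization

/-- The points of `PG(n, q)`, where the field `F` has order `q`. -/
abbrev Pt (F : Type) [Field F] (n : ℕ) := Projectivization F (Fin (n + 1) → F)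

variable {F : Type} [Field F]

/-- A point of `PG(n,q)` lies in the projective subspace determined by a linear subspace `W`. -/
def ptIn {n : ℕ} (P : Pt F n) (W : Submodule F (Fin (n + 1) → F)) : Prop :=
  Projectivization.submodule P ≤ W

/-- The set of points of the projective subspace determined by a linear subspace `W`. -/
def ptsIn {n : ℕ} (W : Submodule F (Fin (n + 1) → F)) : Set (Pt F n) :=
  {P | ptIn P W}

/-- The incidence vector (over `F_p = ZMod p`) of the projective subspace determined by `W`. -/
def incVec (p : ℕ) {n : ℕ} (W : Submodule F (Fin (n + 1) → F)) : Pt F n → ZMod p :=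
  fun P => if ptIn P W then (1 : ZMod p) else 0

/-- The code `C_{n-1}(n,q)`: the `F_p`-span of the incidence vectors of all hyperplanes
(projective dimension `n-1`, i.e. linear dimension `n`). -/
def code (F : Type) [Field F] (p n : ℕ) : Submodule (ZMod p) (Pt F n → ZMod p) :=
  Submodule.span (ZMod p)
    {v | ∃ W : Submodule F (Fin (n + 1) → F), Module.finrank F W = n ∧ v = incVec p W}

/-- The support of a word. -/
def supp {p n : ℕ} (v : Pt F n → ZMod p) : Set (Pt F n) := {P | v P ≠ 0}

/-- The weight of a word. -/
def wt {p n : ℕ} (v : Pt F n → ZMod p) : ℕ := (supp v).ncard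

/-- The weight of the restriction of a word to the subspace determined by `W`. -/
def wtRes {p n : ℕ} (c : Pt F n → ZMod p) (W : Submodule F (Fin (n + 1) → F)) : ℕ :=
  (ptsIn W ∩ supp c).ncard

/-- `θ_m = (q^(m+1) - 1)/(q - 1)`, with `θ_m = 0` for `m < 0`. -/
def theta (q : ℕ) (m : ℤ) : ℕ :=
  if m < 0 then 0 else ∑ i ∈ Finset.range (m.toNat + 1), q ^ i

/-- The bound `B_{n,q}` from the paper. -/
def B (n q : ℕ) : ℝ :=
  if q < 7 ∨ q = 8 ∨ q = 9 ∨ q = 16 ∨ q = 25 ∨ q = 27 ∨ q = 49 then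
    2 * (q : ℝ) ^ (n - 1)
  else if q = 7 ∨ q = 11 ∨ q = 13 ∨ q = 17 then
    (3 * q - Real.sqrt (6 * q) - 1 / 2) * (q : ℝ) ^ (n - 2)
  else if q = 19 ∨ q = 121 then
    (3 * q - Real.sqrt (6 * q) + 9 / 2) * (q : ℝ) ^ (n - 2)
  else if q = 29 ∨ q = 31 ∨ q = 32 then
    (4 * q - 4 * Real.sqrt q - 25 / 2) * (q : ℝ) ^ (n - 2)
  else
    (4 * q - Real.sqrt (8 * q) - 33 / 2) * (q : ℝ) ^ (n - 2)

/-- A line of `PG(n,q)`: a linear subspace of dimension `2`. -/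
def IsLine {n : ℕ} (l : Submodule F (Fin (n + 1) → F)) : Prop := Module.finrank F l = 2

/-- A plane of `PG(n,q)`: a linear subspace of dimension `3`. -/
def IsPlane {n : ℕ} (W : Submodule F (Fin (n + 1) → F)) : Prop := Module.finrank F W = 3

/-- The line `l` is an `α`-secant to `supp c`. -/
def secant {p n : ℕ} (c : Pt F n → ZMod p) (l : Submodule F (Fin (n + 1) → F)) (α : ℕ) : Prop :=
  IsLine l ∧ (ptsIn l ∩ supp c).ncard = α

/-- The restriction of `c` to the plane `W` is a linear combination of at most two lines of `W`. -/
def TwoLineComb (p : ℕ) {n : ℕ} (c : Pt F n → ZMod p) (W : Submodule F (Fin (n + 1) → F)) :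
    Prop :=
  ∃ l₁ l₂ : Submodule F (Fin (n + 1) → F), IsLine l₁ ∧ IsLine l₂ ∧ l₁ ≤ W ∧ l₂ ≤ W ∧
    ∃ a b : ZMod p, ∀ P : Pt F n, ptIn P W → c P = a * incVec p l₁ P + b * incVec p l₂ P

/-- Type `T^△`: the restriction of `c` to the plane `W` is a linear combination (with nonzero
coefficients) of three nonconcurrent lines of `W`. -/
def TypeTri (p : ℕ) {n : ℕ} (c : Pt F n → ZMod p) (W : Submodule F (Fin (n + 1) → F)) : Prop :=
  ∃ l₁ l₂ l₃ : Submodule F (Fin (n + 1) → F),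
    IsLine l₁ ∧ IsLine l₂ ∧ IsLine l₃ ∧ l₁ ≤ W ∧ l₂ ≤ W ∧ l₃ ≤ W ∧
    l₁ ≠ l₂ ∧ l₁ ≠ l₃ ∧ l₂ ≠ l₃ ∧
    (¬ ∃ P : Pt F n, ptIn P l₁ ∧ ptIn P l₂ ∧ ptIn P l₃) ∧
    ∃ a₁ a₂ a₃ : ZMod p, a₁ ≠ 0 ∧ a₂ ≠ 0 ∧ a₃ ≠ 0 ∧
      ∀ P : Pt F n, ptIn P W →
        c P = a₁ * incVec p l₁ P + a₂ * incVec p l₂ P + a₃ * incVec p l₃ P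

/-- Type `T^★`: the restriction of `c` to the plane `W` is a linear combination (with nonzero
coefficients) of three distinct concurrent lines of `W`. -/
def TypeStar (p : ℕ) {n : ℕ} (c : Pt F n → ZMod p) (W : Submodule F (Fin (n + 1) → F)) : Prop :=
  ∃ l₁ l₂ l₃ : Submodule F (Fin (n + 1) → F),
    IsLine l₁ ∧ IsLine l₂ ∧ IsLine l₃ ∧ l₁ ≤ W ∧ l₂ ≤ W ∧ l₃ ≤ W ∧
    l₁ ≠ l₂ ∧ l₁ ≠ l₃ ∧ l₂ ≠ l₃ ∧
    (∃ P : Pt F n, ptIn P l₁ ∧ ptIn P l₂ ∧ ptIn P l₃) ∧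
    ∃ a₁ a₂ a₃ : ZMod p, a₁ ≠ 0 ∧ a₂ ≠ 0 ∧ a₃ ≠ 0 ∧
      ∀ P : Pt F n, ptIn P W →
        c P = a₁ * incVec p l₁ P + a₂ * incVec p l₂ P + a₃ * incVec p l₃ P

/-- The base code word `c₀` of the `T^odd` construction on `PG(2,p)`:
`c₀(0,1,a) = a`, `c₀(1,0,b) = b`, `c₀(1,1,c) = -c`, and `c₀ = 0` elsewhere. -/
def oddBase (p : ℕ) [Fact p.Prime] : Pt (ZMod p) 2 → ZMod p := fun P =>
  if P.rep 0 = 0 ∧ P.rep 1 ≠ 0 then P.rep 2 / P.rep 1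
  else if P.rep 1 = 0 ∧ P.rep 0 ≠ 0 then P.rep 2 / P.rep 0
  else if P.rep 0 = P.rep 1 ∧ P.rep 0 ≠ 0 then -(P.rep 2 / P.rep 0)
  else 0

/-- The line `m : X₀ = 0` of `PG(2,p)`. -/
def lineM1 (p : ℕ) [Fact p.Prime] : Submodule (ZMod p) (Fin 3 → ZMod p) :=
  LinearMap.ker (LinearMap.proj 0 : (Fin 3 → ZMod p) →ₗ[ZMod p] ZMod p)

/-- The line `m' : X₁ = 0` of `PG(2,p)`. -/
def lineM2 (p : ℕ) [Fact p.Prime] : Submodule (ZMod p) (Fin 3 → ZMod p) :=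
  LinearMap.ker (LinearMap.proj 1 : (Fin 3 → ZMod p) →ₗ[ZMod p] ZMod p)

/-- The line `m'' : X₀ = X₁` of `PG(2,p)`. -/
def lineM3 (p : ℕ) [Fact p.Prime] : Submodule (ZMod p) (Fin 3 → ZMod p) :=
  LinearMap.ker ((LinearMap.proj 0 : (Fin 3 → ZMod p) →ₗ[ZMod p] ZMod p) - LinearMap.proj 1)

/-- The code word `d = (γ c₀ + λ m + λ' m' + λ'' m'')^π` of the `T^odd` construction, where the
collineation `π` of `PG(2,p)` is the inverse of the homography induced by the linear
equivalence `g`. -/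
def oddWord (p : ℕ) [Fact p.Prime] (g : (Fin 3 → ZMod p) ≃ₗ[ZMod p] (Fin 3 → ZMod p))
    (γ lam lam' lam'' : ZMod p) : Pt (ZMod p) 2 → ZMod p := fun P =>
  γ * oddBase p (Projectivization.map g.toLinearMap g.injective P) +
    lam * incVec p (lineM1 p) (Projectivization.map g.toLinearMap g.injective P) +
    lam' * incVec p (lineM2 p) (Projectivization.map g.toLinearMap g.injective P) +
    lam'' * incVec p (lineM3 p) (Projectivization.map g.toLinearMap g.injective P)

/-- The semilinear embedding of `PG(2,p)` onto the plane of `PG(n,q)` spanned by the linearly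
independent vectors `b 0, b 1, b 2`, relative to the field embedding `σ : F_p → F`. -/
def planeEmbed {n : ℕ} {p : ℕ} [Fact p.Prime] (σ : ZMod p →+* F)
    (b : Fin 3 → (Fin (n + 1) → F)) (hb : LinearIndependent F b) :
    Pt (ZMod p) 2 → Pt F n := fun P =>
  Projectivization.mk F (∑ i, σ (P.rep i) • b i) (by
    intro hzero
    have h0 : ∀ i ∈ Finset.univ, σ (P.rep i) = 0 :=
      linearIndependent_iff'.mp hb Finset.univ (fun i => σ (P.rep i)) hzero
    have h1 : P.rep = 0 := funext fun i => σ.injective (by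
      simp only [Pi.zero_apply, map_zero]; exact h0 i (Finset.mem_univ i))
    exact P.rep_nonzero h1)

/-- Type `T^odd`: this requires `q = p` to be prime (`|F| = p`), and `c` restricted to the plane
`W` (spanned by the frame `b`) must coincide, via a semilinear identification of `W` with
`PG(2,p)`, with a code word `d` of the `T^odd` construction. -/
def TypeOdd (p : ℕ) [Fact p.Prime] [Fintype F] {n : ℕ} (c : Pt F n → ZMod p)
    (W : Submodule F (Fin (n + 1) → F)) : Prop :=
  Fintype.card F = p ∧
  ∃ (σ : ZMod p →+* F) (b : Fin 3 → (Fin (n + 1) → F)) (hb : LinearIndependent F b),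
    Submodule.span F (Set.range b) = W ∧
    ∃ (g : (Fin 3 → ZMod p) ≃ₗ[ZMod p] (Fin 3 → ZMod p)) (γ lam lam' lam'' : ZMod p), γ ≠ 0 ∧
      ∀ Q : Pt (ZMod p) 2, c (planeEmbed σ b hb Q) = oddWord p g γ lam lam' lam'' Q

/-- The list of plane types `T_0, T_{q+1}, T_{2q}, T_{2q+1}, T^odd, T^△, T^★`. -/
inductive PlaneT : Type where
  | T0 | Tq1 | T2q | T2q1 | Todd | Ttri | Tstar
deriving DecidableEq

/-- The restriction of `c` to the plane `W` is a code word of the given type. -/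
def PlaneIsType (p q : ℕ) [Fact p.Prime] [Fintype F] {n : ℕ} (c : Pt F n → ZMod p)
    (W : Submodule F (Fin (n + 1) → F)) : PlaneT → Prop
  | .T0 => TwoLineComb p c W ∧ wtRes c W = 0
  | .Tq1 => TwoLineComb p c W ∧ wtRes c W = q + 1
  | .T2q => TwoLineComb p c W ∧ wtRes c W = 2 * q
  | .T2q1 => TwoLineComb p c W ∧ wtRes c W = 2 * q + 1
  | .Todd => TypeOdd p c W
  | .Ttri => TypeTri p c W
  | .Tstar => TypeStar p c W

/-- The plane `W` is of type `𝒯`. -/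
def TypeT (p q : ℕ) [Fact p.Prime] [Fintype F] {n : ℕ} (c : Pt F n → ZMod p)
    (W : Submodule F (Fin (n + 1) → F)) : Prop :=
  IsPlane W ∧ ∃ t : PlaneT, PlaneIsType p q c W t

/-- The plane `W` is of type `𝒪`. -/
def TypeO (p q : ℕ) [Fact p.Prime] [Fintype F] {n : ℕ} (c : Pt F n → ZMod p)
    (W : Submodule F (Fin (n + 1) → F)) : Prop :=
  IsPlane W ∧ ¬ TypeT p q c W

/-- The restriction of `c` to the `k`-space `Sp` (linear dimension `k+1`) is of type `t`:
there is a `(k-3)`-space `κ ⊆ Sp` on which `c` is a scalar multiple of the all-one function,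
a plane `π ⊆ Sp` of type `t` disjoint from `κ`, and `c P = c (⟨κ, P⟩ ∩ π)` for every point
`P` of `Sp` outside `κ`. -/
def SpaceIsType (p q : ℕ) [Fact p.Prime] [Fintype F] {n : ℕ} (c : Pt F n → ZMod p)
    (Sp : Submodule F (Fin (n + 1) → F)) (k : ℕ) (t : PlaneT) : Prop :=
  Module.finrank F Sp = k + 1 ∧
  ∃ κ : Submodule F (Fin (n + 1) → F), Module.finrank F κ = k - 2 ∧ κ ≤ Sp ∧
    (∃ a : ZMod p, ∀ P : Pt F n, ptIn P κ → c P = a) ∧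
    ∃ π : Submodule F (Fin (n + 1) → F), IsPlane π ∧ π ≤ Sp ∧ π ⊓ κ = ⊥ ∧
      PlaneIsType p q c π t ∧
      ∀ P : Pt F n, ptIn P Sp → ¬ ptIn P κ →
        ∃ Q : Pt F n, ptIn Q π ∧
          Projectivization.submodule Q ≤ κ ⊔ Projectivization.submodule P ∧ c P = c Q
/-! ### Counting in finite projective planes -/

section Combinatorics

open Finset Configuration
open Configuration.ProjectivePlane (order one_lt_order card_lines lineCount_eq pointCount_eq)
open Configuration.Nondegenerate (exists_line eq_or_eq)
open Configuration.HasPoints (mkPoint mkPoint_ax)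
open Configuration.HasLines (mkLine mkLine_ax)

variable {X Λ : Type*} [Membership X Λ]

/-- The points of a line, as a finset. -/
def onLine (X : Type*) [Membership X Λ] [Fintype X] (l : Λ) : Finset X := univ.filter (· ∈ l)

/-- The lines through a point, as a finset. -/
def thru (Λ : Type*) [Membership X Λ] [Fintype Λ] (x : X) : Finset Λ := univ.filter (x ∈ ·)

@[simp] theorem mem_onLine [Fintype X] {l : Λ} {x : X} : x ∈ onLine X l ↔ x ∈ l := by simp [onLine]

@[simp] theorem mem_thru [Fintype Λ] {l : Λ} {x : X} : l ∈ thru Λ x ↔ x ∈ l := by simp [thru]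

/-- The number of points of a line at which `c` does not vanish. -/
def secantSize {R : Type*} [Fintype X] [Zero R] (c : X → R) (l : Λ) : ℕ :=
  #{x ∈ onLine X l | c x ≠ 0}

/-- `c` has the same sum `α` along each line. -/
def LineSum (Λ : Type*) {R : Type*} [Membership X Λ] [Fintype X] [AddCommMonoid R]
    (c : X → R) (α : R) : Prop :=
  ∀ l : Λ, ∑ x ∈ onLine X l, c x = α

theorem LineSum.eq_sum {R : Type*} [Fintype X] [AddCommMonoid R] {c : X → R} {α : R}
    (hc : LineSum Λ c α) (l : Λ) (A : Finset X) (hA : ∀ x ∈ A, x ∈ l)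
    (h0 : ∀ x, x ∈ l → c x ≠ 0 → x ∈ A) :
    ∑ x ∈ A, c x = α := by
  rw [← hc l]
  refine sum_subset (fun x hx => mem_onLine.2 (hA x hx)) fun x hx hxA => ?_
  by_contra h
  exact hxA (h0 x (mem_onLine.1 hx) h)

theorem sum_secantSize_le [Fintype X] [ProjectivePlane X Λ] {R : Type*} [Zero R]
    (c : X → R) (T : Finset Λ) :
    2 * ∑ l ∈ T, secantSize c l ≤
      2 * #(T.biUnion fun l => {x ∈ onLine X l | c x ≠ 0}) + #T * (#T - 1) := by
  induction T using Finset.induction_on with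
  | empty => simp
  | insert l T hl ih =>
    rw [sum_insert hl, biUnion_insert, card_insert_of_notMem hl]
    have h1 := card_union_add_card_inter {x ∈ onLine X l | c x ≠ 0}
      (T.biUnion fun l => {x ∈ onLine X l | c x ≠ 0})
    have h2 : #({x ∈ onLine X l | c x ≠ 0} ∩ T.biUnion fun l => {x ∈ onLine X l | c x ≠ 0}) ≤
        #T := by
      rw [inter_biUnion]
      refine (card_biUnion_le_card_mul _ _ 1 fun m hm => ?_).trans (by simp)
      refine card_le_one.2 fun a ha b hb => ?_
      simp only [mem_inter, mem_filter, mem_onLine] at ha hb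
      exact (eq_or_eq ha.1.1 hb.1.1 ha.2.1 hb.2.1).resolve_right (fun h => hl (h ▸ hm))
    have h3 : #{x ∈ onLine X l | c x ≠ 0} = secantSize c l := rfl
    rw [h3] at h1
    have h4 : #T * (#T - 1) + 2 * #T = (#T + 1) * #T := by
      rcases #T with _ | t
      · rfl
      · rw [Nat.add_sub_cancel]
        ring
    rw [Nat.add_sub_cancel]
    linarith

/-- The sum of `c` over a line through the intersection of two of the lines covering its
support. -/
theorem add_eq_of_vertex [Fintype X] [ProjectivePlane X Λ] {R : Type*} [AddCommGroup R]
    {c : X → R} {α : R} (hc : LineSum Λ c α)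
    {l m k : Λ} (hcov : ∀ x, c x ≠ 0 → x ∈ l ∨ x ∈ m ∨ x ∈ k) {z x : X} (zl : z ∈ l) (zm : z ∈ m)
    (zk : z ∉ k) (hx : x ∈ k) (hxl : x ∉ l) (hxm : x ∉ m) : c z + c x = α := by
  have hzx : z ≠ x := fun h => zk (h ▸ hx)
  obtain ⟨h1, h2⟩ := mkLine_ax (L := Λ) hzx
  set r : Λ := mkLine hzx
  rw [← sum_pair (f := c) hzx]
  refine hc.eq_sum r _ (by simp [h1, h2]) fun w hw hw0 => ?_
  rcases hcov w hw0 with h | h | h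
  · have := (eq_or_eq hw h1 h zl).resolve_right fun e => hxl (e ▸ h2)
    simp [this]
  · have := (eq_or_eq hw h1 h zm).resolve_right fun e => hxm (e ▸ h2)
    simp [this]
  · have := (eq_or_eq hw h2 h hx).resolve_right fun e => zk (e ▸ h1)
    simp [this]

variable [Fintype X] [Fintype Λ] [ProjectivePlane X Λ]

variable (X) in
theorem card_onLine (l : Λ) : #(onLine X l) = order X Λ + 1 := by
  rw [← pointCount_eq X l, pointCount, Nat.card_eq_fintype_card, Fintype.card_subtype, onLine]

variable (Λ) in
theorem card_thru (x : X) : #(thru Λ x) = order X Λ + 1 := by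
  rw [← lineCount_eq (L := Λ) x, lineCount, Nat.card_eq_fintype_card, Fintype.card_subtype, thru]

theorem sum_thru_erase {M : Type*} [AddCommMonoid M] (f : X → M) (x : X) :
    ∑ l ∈ thru Λ x, ∑ y ∈ (onLine X l).erase x, f y = ∑ y ∈ univ.erase x, f y := by
  have h1 : ∀ l ∈ thru Λ x, ∑ y ∈ (onLine X l).erase x, f y =
      ∑ y ∈ univ.erase x, if y ∈ l then f y else 0 := by
    intro l _
    rw [← sum_filter]
    refine sum_congr ?_ fun _ _ => rfl
    ext y
    simp
  rw [sum_congr rfl h1, sum_comm]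
  refine sum_congr rfl fun y hy => ?_
  have hxy : x ≠ y := fun h => (mem_erase.1 hy).1 h.symm
  rw [sum_eq_single (mkLine hxy : Λ)]
  · rw [if_pos (mkLine_ax hxy).2]
  · intro l hl hne
    rw [if_neg]
    intro hyl
    exact hne ((eq_or_eq (mem_thru.1 hl) hyl (mkLine_ax hxy).1 (mkLine_ax hxy).2).resolve_left hxy)
  · intro h
    exact absurd (mem_thru.2 (mkLine_ax hxy).1) h

theorem sum_thru {M : Type*} [AddCommMonoid M] (f : X → M) (x : X) :
    ∑ l ∈ thru Λ x, ∑ y ∈ onLine X l, f y = ∑ y, f y + order X Λ • f x := by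
  have h1 : ∀ l ∈ thru Λ x, ∑ y ∈ onLine X l, f y = f x + ∑ y ∈ (onLine X l).erase x, f y :=
    fun l hl => (add_sum_erase _ _ (mem_onLine.2 (mem_thru.1 hl))).symm
  rw [sum_congr rfl h1, sum_add_distrib, sum_const, card_thru, sum_thru_erase,
    ← add_sum_erase univ f (mem_univ x), succ_nsmul]
  abel

theorem sum_secantSize {R : Type*} [Zero R] (c : X → R) (x : X) :
    ∑ l ∈ thru Λ x, secantSize c l =
      #{y | c y ≠ 0} + order X Λ * (if c x ≠ 0 then 1 else 0) := by
  have := sum_thru (Λ := Λ) (fun y => if c y ≠ 0 then 1 else 0 : X → ℕ) x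
  simpa only [secantSize, card_filter, smul_eq_mul] using this

/-- The inequality bounding how much shorter than a given secant the other lines through
a zero of `c` can be. -/
def PencilBound (Λ : Type*) {R : Type*} [Membership X Λ] [Fintype Λ] [ProjectivePlane X Λ]
    [Zero R] (c : X → R) : Prop :=
  ∀ x, c x = 0 → ∀ l : Λ, x ∈ l →
    (order X Λ + 2) * secantSize c l ≤ #{y | c y ≠ 0} + secantSize c l * secantSize c l

theorem secantSize_dichotomy {R : Type*} [Zero R] {c : X → R} (hA : PencilBound Λ c) {e : ℕ}
    (he : e < order X Λ) (hS : #{y | c y ≠ 0} < (e + 2) * (order X Λ - e)) (l : Λ) :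
    secantSize c l ≤ e + 1 ∨ order X Λ + 1 ≤ secantSize c l + e := by
  by_cases hl : ∀ x ∈ onLine X l, c x ≠ 0
  · right
    rw [secantSize, filter_true_of_mem hl, card_onLine]
    omega
  · push Not at hl
    obtain ⟨x, hxl, hx⟩ := hl
    have h := hA x hx l (mem_onLine.1 hxl)
    by_contra! hcon
    obtain ⟨h1, h2⟩ := hcon
    generalize secantSize c l = s at *
    generalize order X Λ = n at *
    obtain ⟨k, rfl⟩ := Nat.exists_eq_add_of_lt he
    obtain ⟨i, rfl⟩ := Nat.exists_eq_add_of_lt h1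
    have h3 : i ≤ k := by omega
    obtain ⟨j, rfl⟩ := Nat.exists_eq_add_of_le h3
    rw [show e + (i + j) + 1 - e = i + j + 1 by omega] at hS
    nlinarith

theorem exists_long_line {R : Type*} [AddCommGroup R] {c : X → R} {α : R} (hc : LineSum Λ c α)
    (hA : PencilBound Λ c) (e : ℕ) (he : e * e + e < order X Λ)
    (hS : #{y | c y ≠ 0} < (e + 2) * (order X Λ - e)) {x : X} (hx : c x ≠ 0) :
    ∃ l : Λ, x ∈ l ∧ order X Λ + 1 ≤ secantSize c l + e := by
  have key : ∀ e : ℕ, e * e + e < order X Λ → #{y | c y ≠ 0} < (e + 2) * (order X Λ - e) →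
      (∀ l : Λ, x ∈ l → ¬ order X Λ + 1 ≤ secantSize c l + e) →
      #{y | c y ≠ 0} ≤ e * order X Λ + e + 1 := by
    intro e he hS hno
    have h1 : ∑ l ∈ thru Λ x, secantSize c l ≤ ∑ l ∈ thru Λ x, (e + 1) :=
      sum_le_sum fun l hl => (secantSize_dichotomy hA (by nlinarith) hS l).resolve_right
        (hno l (mem_thru.1 hl))
    rw [sum_secantSize, sum_const, card_thru, if_pos hx, smul_eq_mul] at h1
    nlinarith
  induction e with
  | zero =>
    by_contra! hno
    have h1 := key 0 he hS fun l hl => not_le.2 (hno l hl)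
    have h2 : ∀ y, c y ≠ 0 → y = x := fun y hy =>
      card_le_one.1 (by simpa using h1) y (by simpa using hy) x (by simpa using hx)
    obtain ⟨l, hl⟩ := exists_line (P := X) (L := Λ) x
    have h3 : α = 0 := by
      rw [← hc l]
      refine sum_eq_zero fun y hy => ?_
      by_contra hy0
      exact hl (h2 y hy0 ▸ mem_onLine.1 hy)
    obtain ⟨m, hm⟩ : (thru Λ x).Nonempty := card_pos.1 (by rw [card_thru]; omega)
    have h4 := hc m
    rw [sum_eq_single x (fun y _ hyx => by_contra fun h => hyx (h2 y h))
      (fun h => absurd (mem_onLine.2 (mem_thru.1 hm)) h)] at h4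
    exact hx (h4.trans h3)
  | succ e ih =>
    by_contra! hno
    have h1 := key (e + 1) he hS fun l hl => not_le.2 (hno l hl)
    obtain ⟨l, hl, hl'⟩ := ih (by nlinarith) (by
      obtain ⟨k, hk⟩ := Nat.exists_eq_add_of_le (show e ≤ order X Λ by nlinarith)
      rw [hk] at h1 he
      rw [hk, Nat.add_sub_cancel_left]
      nlinarith)
    have := hno l hl
    omega

/-- If every point of the support lies on a long line and the support is small, then it is
covered by few lines. -/
theorem exists_cover {R : Type*} [Zero R] {c : X → R} {e : ℕ} (he : e < order X Λ)
    (hcov : ∀ x, c x ≠ 0 → ∃ l : Λ, x ∈ l ∧ order X Λ + 1 ≤ secantSize c l + e)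
    (hS : 2 * #{y | c y ≠ 0} + (e + 2) * (e + 1) < 2 * ((e + 2) * (order X Λ + 1 - e))) :
    ∃ T : Finset Λ, #T = e + 1 ∧ ∀ x, c x ≠ 0 → ∃ l ∈ T, x ∈ l := by
  have h1 : #{l : Λ | order X Λ + 1 ≤ secantSize c l + e} ≤ e + 1 := by
    by_contra! h
    obtain ⟨T, hT, hcard⟩ := exists_subset_card_eq (show e + 2 ≤ _ from h)
    have h2 := sum_secantSize_le c T
    have h3 : ∑ l ∈ T, (order X Λ + 1 - e) ≤ ∑ l ∈ T, secantSize c l :=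
      sum_le_sum fun l hl => by
        have := (mem_filter.1 (hT hl)).2
        omega
    have h4 : #(T.biUnion fun l => {x ∈ onLine X l | c x ≠ 0}) ≤ #{y | c y ≠ 0} := by
      refine card_le_card fun x hx => ?_
      obtain ⟨l, -, hl⟩ := mem_biUnion.1 hx
      simpa using (mem_filter.1 hl).2
    rw [sum_const, hcard, smul_eq_mul] at h3
    rw [hcard, show e + 2 - 1 = e + 1 by omega] at h2
    omega
  have h5 : e + 1 ≤ Fintype.card Λ := by
    rw [card_lines (P := X) (L := Λ)]
    nlinarith
  obtain ⟨T, hT, hcard⟩ := exists_superset_card_eq h1 h5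
  exact ⟨T, hcard, fun x hx => by
    obtain ⟨l, hl, hl'⟩ := hcov x hx
    exact ⟨l, hT (by simpa using hl'), hl⟩⟩

variable (X) in
theorem exists_mem_line_notMem (l : Λ) (A : Finset X) (hA : #A ≤ 2) : ∃ x, x ∈ l ∧ x ∉ A := by
  obtain ⟨x, hx, hxA⟩ := exists_mem_notMem_of_card_lt_card (s := A) (t := onLine X l) (by
    have := one_lt_order X Λ
    rw [card_onLine]
    omega)
  exact ⟨x, mem_onLine.1 hx, hxA⟩

variable (Λ) in
theorem exists_line_thru_notMem (x : X) (A : Finset Λ) (hA : #A ≤ order X Λ) :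
    ∃ l : Λ, x ∈ l ∧ l ∉ A := by
  obtain ⟨l, hl, hlA⟩ := exists_mem_notMem_of_card_lt_card (s := A) (t := thru Λ x) (by
    rw [card_thru]
    omega)
  exact ⟨l, mem_thru.1 hl, hlA⟩

theorem eq_two_lines {R : Type*} [AddCommGroup R] {c : X → R} {α : R} (hc : LineSum Λ c α)
    {l m : Λ} (hlm : l ≠ m) (hcov : ∀ x, c x ≠ 0 → x ∈ l ∨ x ∈ m) :
    ∃ a b : R, ∀ x, c x = (if x ∈ l then a else 0) + (if x ∈ m then b else 0) := by
  obtain ⟨zl, zm⟩ := mkPoint_ax (P := X) hlm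
  set z : X := mkPoint hlm
  have uz : ∀ x, x ∈ l → x ∈ m → x = z := fun x h1 h2 =>
    (eq_or_eq h1 zl h2 zm).resolve_right hlm
  have key : ∀ x y, x ∈ l → x ≠ z → y ∈ m → y ≠ z → c x + c y = α := by
    intro x y hx hxz hy hyz
    have hxy : x ≠ y := fun h => hxz (uz x hx (h ▸ hy))
    obtain ⟨h1, h2⟩ := mkLine_ax (L := Λ) hxy
    set k : Λ := mkLine hxy
    rw [← sum_pair (f := c) hxy]
    refine hc.eq_sum k _ (by simp [h1, h2]) fun w hw hw0 => ?_
    rcases hcov w hw0 with h | h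
    · rcases eq_or_eq hw h1 h hx with e | e
      · simp [e]
      · exact absurd (uz y (e ▸ h2) hy) hyz
    · rcases eq_or_eq hw h2 h hy with e | e
      · simp [e]
      · exact absurd (uz x hx (e ▸ h1)) hxz
  obtain ⟨x, hx, hxz⟩ := exists_mem_line_notMem X l {z} (by simp)
  obtain ⟨y, hy, hyz⟩ := exists_mem_line_notMem X m {z} (by simp)
  rw [mem_singleton] at hxz hyz
  have hz : c z = α := by
    obtain ⟨k, hk, hk'⟩ := exists_line_thru_notMem Λ z {l, m}
      (card_le_two.trans (one_lt_order X Λ))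
    simp only [mem_insert, mem_singleton, not_or] at hk'
    rw [← sum_singleton c z]
    refine hc.eq_sum k _ (by simp [hk]) fun w hw hw0 => ?_
    rw [mem_singleton]
    rcases hcov w hw0 with h | h
    · exact (eq_or_eq hw hk h zl).resolve_right hk'.1
    · exact (eq_or_eq hw hk h zm).resolve_right hk'.2
  have hxy := key x y hx hxz hy hyz
  refine ⟨c x, c y, fun w => ?_⟩
  by_cases h1 : w ∈ l <;> by_cases h2 : w ∈ m
  · rw [if_pos h1, if_pos h2, uz w h1 h2, hz, hxy]
  · have := key w y h1 (fun h => h2 (h ▸ zm)) hy hyz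
    rw [if_pos h1, if_neg h2, add_zero, ← add_left_inj (c y), this, hxy]
  · have := key x w hx hxz h2 (fun h => h1 (h ▸ zl))
    rw [if_neg h1, if_pos h2, zero_add, ← add_right_inj (c x), this, hxy]
  · rw [if_neg h1, if_neg h2, add_zero]
    by_contra h
    rcases hcov w h with h | h
    exacts [h1 h, h2 h]

theorem eq_triangle {R : Type*} [AddCommGroup R] {c : X → R} {α : R} (hc : LineSum Λ c α)
    {l m k : Λ} (hlm : l ≠ m) (hlk : l ≠ k) (hmk : m ≠ k)
    (hcon : ∀ x, x ∈ l → x ∈ m → x ∉ k) (hcov : ∀ x, c x ≠ 0 → x ∈ l ∨ x ∈ m ∨ x ∈ k) :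
    ∃ a b d : R, ∀ x, c x =
      (if x ∈ l then a else 0) + (if x ∈ m then b else 0) + (if x ∈ k then d else 0) := by
  obtain ⟨kl, km⟩ := mkPoint_ax (P := X) hlm
  set zk : X := mkPoint hlm
  obtain ⟨ml, mk⟩ := mkPoint_ax (P := X) hlk
  set zm : X := mkPoint hlk
  obtain ⟨lm, lk⟩ := mkPoint_ax (P := X) hmk
  set zl : X := mkPoint hmk
  have hk : zk ∉ k := hcon _ kl km
  have hm : zm ∉ m := fun h => hcon _ ml h mk
  have hl : zl ∉ l := fun h => hcon _ h lm lk
  have Hl : ∀ x, x ∈ l → x ∉ m → x ∉ k → c x = α - c zl := fun x h1 h2 h3 =>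
    eq_sub_of_add_eq' (add_eq_of_vertex hc (l := m) (m := k) (k := l)
      (fun x hx => by have := hcov x hx; tauto) lm lk hl h1 h2 h3)
  have Hm : ∀ x, x ∈ m → x ∉ l → x ∉ k → c x = α - c zm := fun x h1 h2 h3 =>
    eq_sub_of_add_eq' (add_eq_of_vertex hc (l := l) (m := k) (k := m)
      (fun x hx => by have := hcov x hx; tauto) ml mk hm h1 h2 h3)
  have Hk : ∀ x, x ∈ k → x ∉ l → x ∉ m → c x = α - c zk := fun x h1 h2 h3 =>
    eq_sub_of_add_eq' (add_eq_of_vertex hc (l := l) (m := m) (k := k)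
      (fun x hx => by have := hcov x hx; tauto) kl km hk h1 h2 h3)
  have U : ∀ {r s : Λ} {y z : X}, r ≠ s → y ∈ r → y ∈ s → z ∈ r → z ∈ s → y = z :=
    fun hrs h1 h2 h3 h4 => (eq_or_eq h1 h3 h2 h4).resolve_right hrs
  obtain ⟨x, hx, hxA⟩ := exists_mem_line_notMem X l {zk, zm} card_le_two
  obtain ⟨y, hy, hyA⟩ := exists_mem_line_notMem X m {zk, zl} card_le_two
  simp only [mem_insert, mem_singleton, not_or] at hxA hyA
  have hxm : x ∉ m := fun h => hxA.1 (U hlm hx h kl km)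
  have hxk : x ∉ k := fun h => hxA.2 (U hlk hx h ml mk)
  have hyl : y ∉ l := fun h => hyA.1 (U hlm h hy kl km)
  have hyk : y ∉ k := fun h => hyA.2 (U hmk hy h lm lk)
  have hxy : x ≠ y := fun h => hxm (h ▸ hy)
  obtain ⟨r1, r2⟩ := mkLine_ax (L := Λ) hxy
  set r : Λ := mkLine hxy
  have hrk : r ≠ k := fun h => hxk (h ▸ r1)
  have hrl : r ≠ l := fun h => hyl (h ▸ r2)
  have hrm : r ≠ m := fun h => hxm (h ▸ r1)
  obtain ⟨wr, wk⟩ := mkPoint_ax (P := X) hrk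
  set w : X := mkPoint hrk
  have hwl : w ∉ l := fun h => hxk (U hrl r1 hx wr h ▸ wk)
  have hwm : w ∉ m := fun h => hyk (U hrm r2 hy wr h ▸ wk)
  have hxw : x ≠ w := fun h => hwl (h ▸ hx)
  have hyw : y ≠ w := fun h => hwm (h ▸ hy)
  have hsum : c x + (c y + c w) = α := by
    rw [← sum_pair (f := c) hyw, ← sum_insert (by simp [hxy, hxw])]
    refine hc.eq_sum r _ (by simp [r1, r2, wr]) fun v hv hv0 => ?_
    rcases hcov v hv0 with h | h | h
    · simp [U hrl hv h r1 hx]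
    · simp [U hrm hv h r2 hy]
    · simp [U hrk hv h wr wk]
  rw [Hl x hx hxm hxk, Hm y hy hyl hyk, Hk w wk hwl hwm] at hsum
  have h2 : c zl + c zm + c zk = α + α := by
    rw [← sub_eq_zero] at hsum ⊢
    rw [← neg_eq_zero, ← hsum]
    abel
  refine ⟨α - c zl, α - c zm, α - c zk, fun v => ?_⟩
  by_cases vl : v ∈ l <;> by_cases vm : v ∈ m <;> by_cases vk : v ∈ k <;>
    simp only [vl, vm, vk, if_true, if_false, add_zero, zero_add]
  · exact absurd vk (hcon v vl vm)
  · rw [U hlm vl vm kl km, ← sub_eq_zero, ← sub_eq_zero.2 h2]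
    abel
  · rw [U hlk vl vk ml mk, ← sub_eq_zero, ← sub_eq_zero.2 h2]
    abel
  · exact Hl v vl vm vk
  · rw [U hmk vm vk lm lk, ← sub_eq_zero, ← sub_eq_zero.2 h2]
    abel
  · exact Hm v vm vl vk
  · exact Hk v vk vl vm
  · by_contra h
    rcases hcov v h with h | h | h
    exacts [vl h, vm h, vk h]

end Combinatorics
/-! ### Hankel determinants of moments -/

section Hankel

open Finset Polynomial Matrix

theorem pow_dvd_det_of_eval_eq_zero {K : Type*} [Field K] {s : ℕ} (A : Matrix (Fin s) (Fin s) K[X])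
    (a : K) (U : Matrix (Fin s) (Fin s) K) (hU : U.det = 1) (J : Finset (Fin s))
    (h : ∀ j ∈ J, ∀ i, (A.map (eval a) * U) i j = 0) : (X - C a) ^ #J ∣ A.det := by
  set B := A * U.map C with hB
  have hdet : A.det = B.det := by
    rw [hB, det_mul]
    have : (U.map C).det = C U.det := (RingHom.map_det C U).symm
    rw [this, hU, C_1, mul_one]
  have hdvd : ∀ i j, (if j ∈ J then X - C a else 1) ∣ B i j := by
    intro i j
    split_ifs with hj
    · rw [dvd_iff_isRoot, IsRoot, ← h j hj i, hB]
      simp [Matrix.mul_apply, eval_finsetSum]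
    · exact one_dvd _
  choose B' hB' using hdvd
  have : B = of fun i j => (if j ∈ J then X - C a else 1) * (of B') i j := by
    ext1 i j
    exact hB' i j
  rw [hdet, this, det_mul_row, prod_ite_mem, univ_inter, prod_const]
  exact dvd_mul_right _ _

theorem natDegree_det_hankel_le {K : Type*} [Field K] (s : ℕ) (M : ℕ → K[X])
    (hM : ∀ j, (M j).natDegree ≤ j) :
    (of fun i j : Fin s => M (i + j)).det.natDegree ≤ s * (s - 1) := by
  rw [det_apply]
  refine natDegree_sum_le_of_forall_le _ _ fun σ _ => ?_
  refine (natDegree_smul_le _ _).trans ((natDegree_prod_le _ _).trans ?_)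
  calc ∑ i, (of (fun i j : Fin s => M (i + j)) (σ i) i).natDegree
      ≤ ∑ i, ((σ i : ℕ) + i) := sum_le_sum fun i _ => hM _
    _ = s * (s - 1) := by
      rw [sum_add_distrib, Equiv.sum_comp σ (fun i : Fin s => (i : ℕ)),
        Fin.sum_univ_eq_sum_range (fun i => i), ← mul_two, sum_range_id_mul_two]

/-- If the moments of order `j` of weights on the fibres over `τ i` are the values of a polynomial
of degree at most `j`, then the fibres cannot be much smaller than a given one. -/
theorem sum_fibre_deficit_le {K Ω ι : Type*} [Field K] (I : Finset ι) (τ : ι → K)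
    (hτ : Set.InjOn τ I) (B : ι → Finset Ω) (ξ : Ω → K) (c : Ω → K)
    (hξ : ∀ i ∈ I, Set.InjOn ξ (B i)) (hc : ∀ i ∈ I, ∀ x ∈ B i, c x ≠ 0)
    (hM : ∀ j : ℕ, ∃ f : K[X], f.natDegree ≤ j ∧
      ∀ i ∈ I, f.eval (τ i) = ∑ x ∈ B i, ξ x ^ j * c x) {i₀ : ι} (hi₀ : i₀ ∈ I) :
    ∑ i ∈ I, (#(B i₀) - #(B i)) ≤ #(B i₀) * (#(B i₀) - 1) := by
  choose M hMd hMe using hM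
  set s := #(B i₀) with hs
  set H : Matrix (Fin s) (Fin s) K[X] := of fun i j : Fin s => M (i + j) with hH
  have hHe : ∀ i ∈ I, ∀ k l, H.map (eval (τ i)) k l = ∑ x ∈ B i, ξ x ^ (k + l : ℕ) * c x :=
    fun i hi k l => hMe _ i hi
  have hne : H.det ≠ 0 := by
    intro h0
    set e : Fin s ≃ B i₀ := ((B i₀).equivFinOfCardEq hs.symm).symm
    have h1 : H.map (eval (τ i₀)) = (vandermonde fun k => ξ (e k))ᵀ *
        (diagonal (fun k => c (e k)) * vandermonde fun k => ξ (e k)) := by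
      ext k l
      rw [hHe i₀ hi₀, ← sum_coe_sort, ← e.sum_comp, Matrix.mul_apply]
      refine sum_congr rfl fun m _ => ?_
      rw [diagonal_mul, transpose_apply, vandermonde_apply, vandermonde_apply, pow_add]
      ring
    have h2 : (H.map (eval (τ i₀))).det = 0 := by
      have : (H.map (evalRingHom (τ i₀))).det = evalRingHom (τ i₀) H.det :=
        (RingHom.map_det _ _).symm
      rw [h0, map_zero] at this
      exact this
    rw [h1, det_mul, det_mul, det_transpose, det_diagonal] at h2
    have h3 : (vandermonde fun k => ξ (e k)).det ≠ 0 := by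
      rw [det_vandermonde_ne_zero_iff]
      intro k l hkl
      exact e.injective (Subtype.ext (hξ i₀ hi₀ (e k).2 (e l).2 hkl))
    have h4 : ∏ k, c (e k) ≠ 0 := prod_ne_zero_iff.2 fun k _ => hc i₀ hi₀ _ (e k).2
    exact mul_ne_zero h3 (mul_ne_zero h4 h3) h2
  have hdvd : ∀ i ∈ I, (X - C (τ i)) ^ (s - #(B i)) ∣ H.det := by
    intro i hi
    set r := #(B i)
    set π : K[X] := ∏ x ∈ B i, (X - C (ξ x)) with hπ
    have hπm : π.Monic := monic_prod_of_monic _ _ fun x _ => monic_X_sub_C _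
    have hπd : π.natDegree = r := by
      rw [hπ, natDegree_prod_of_monic _ _ fun x _ => monic_X_sub_C _]
      simp [r]
    set P : Fin s → K[X] := fun j => if (j : ℕ) < r then X ^ (j : ℕ) else X ^ (j - r : ℕ) * π
      with hP
    have hPm : ∀ j, (P j).Monic := by
      intro j
      simp only [hP]
      split_ifs
      exacts [monic_X_pow _, (monic_X_pow _).mul hπm]
    have hPd : ∀ j, (P j).natDegree = j := by
      intro j
      simp only [hP]
      split_ifs with h
      · exact natDegree_X_pow _
      · rw [(monic_X_pow _).natDegree_mul hπm, natDegree_X_pow, hπd]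
        omega
    have hJ : #{j : Fin s | r ≤ j} = s - r := by
      have h1 : #{j : Fin s | ¬ (j : ℕ) < r} = s - r := by
        rw [filter_not, card_sdiff_of_subset (filter_subset _ _), Fin.card_filter_val_lt, card_univ,
          Fintype.card_fin]
        omega
      simpa using h1
    rw [← hJ]
    refine pow_dvd_det_of_eval_eq_zero H (τ i) (of fun (i : Fin s) j => (P j).coeff (i : ℕ))
      (det_matrixOfPolynomials P hPd hPm) _ fun j hj k => ?_
    have hj : r ≤ j := by simpa using hj
    rw [Matrix.mul_apply]
    have h1 : ∀ l : Fin s,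
        H.map (eval (τ i)) k l * (of fun (i : Fin s) j => (P j).coeff (i : ℕ)) l j =
        ∑ x ∈ B i, ξ x ^ (k : ℕ) * c x * ((P j).coeff l * ξ x ^ (l : ℕ)) := by
      intro l
      rw [hHe i hi, sum_mul]
      refine sum_congr rfl fun x _ => ?_
      rw [of_apply, pow_add]
      ring
    rw [sum_congr rfl fun l _ => h1 l, sum_comm]
    refine sum_eq_zero fun x hx => ?_
    rw [← mul_sum, Fin.sum_univ_eq_sum_range (fun l => (P j).coeff l * ξ x ^ l),
      ← eval_eq_sum_range' (by rw [hPd]; exact j.2)]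
    have : eval (ξ x) (P j) = 0 := by
      simp only [hP, if_neg (not_lt.2 hj), hπ, eval_mul, eval_prod]
      rw [prod_eq_zero hx (by simp), mul_zero]
    rw [this, mul_zero]
  have hprod : ∏ i ∈ I, (X - C (τ i)) ^ (s - #(B i)) ∣ H.det := by
    refine prod_dvd_of_coprime (fun i hi j hj hij => ?_) hdvd
    exact (isCoprime_X_sub_C_of_isUnit_sub
      (sub_ne_zero.2 fun h => hij (hτ hi hj h)).isUnit).pow
  have h5 := natDegree_le_of_dvd hprod hne
  rw [natDegree_prod_of_monic _ _ fun i _ => (monic_X_sub_C _).pow _] at h5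
  simp only [natDegree_pow, natDegree_X_sub_C, mul_one] at h5
  exact h5.trans (natDegree_det_hankel_le s M hMd)

end Hankel

/-! ### Words spanned by lines of a projective plane -/

section LineSpan

open Finset Configuration Polynomial
open Configuration.ProjectivePlane (order one_lt_order)
open Configuration.Nondegenerate (eq_or_eq)
open Configuration.HasPoints (mkPoint mkPoint_ax)

/-- The incidence vector of a line. -/
def lineVec {X Λ : Type*} [Membership X Λ] (R : Type*) [Zero R] [One R] (l : Λ) : X → R :=
  fun x => if x ∈ l then 1 else 0

variable {X Λ : Type*} [Membership X Λ] [Fintype X] [Fintype Λ] [ProjectivePlane X Λ]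
  {R : Type*} [CommRing R]

theorem sum_thru_lineVec (hR : (order X Λ : R) = 0) (x : X) :
    ∑ l ∈ thru Λ x, lineVec R l = (1 : X → R) := by
  ext y
  rw [Finset.sum_apply, Pi.one_apply]
  have h := sum_thru (Λ := Λ) (fun z => if z = y then (1 : R) else 0) x
  rw [nsmul_eq_mul, hR, zero_mul, add_zero, sum_ite_eq' univ y] at h
  rw [← (h.trans (if_pos (mem_univ y)))]
  refine sum_congr rfl fun l _ => ?_
  rw [sum_ite_eq' (onLine X l) y]
  simp [lineVec]

theorem exists_lineSum_of_mem_span (hR : (order X Λ : R) = 0) {c : X → R}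
    (hc : c ∈ Submodule.span R (Set.range (lineVec R : Λ → X → R))) : ∃ α, LineSum Λ c α := by
  induction hc using Submodule.span_induction with
  | mem v hv =>
    obtain ⟨l, rfl⟩ := hv
    refine ⟨1, fun m => ?_⟩
    by_cases hlm : l = m
    · subst hlm
      have h1 : ∀ x ∈ onLine X l, lineVec R l x = 1 := fun x hx => if_pos (mem_onLine.1 hx)
      rw [sum_congr rfl h1, sum_const, card_onLine,
        nsmul_eq_mul, Nat.cast_add, hR]
      simp
    · obtain ⟨zl, zm⟩ := mkPoint_ax (P := X) hlm
      rw [sum_eq_single (mkPoint hlm : X)]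
      · exact if_pos zl
      · intro y hy hne
        refine if_neg fun hyl => hne ?_
        exact (eq_or_eq hyl zl (mem_onLine.1 hy) zm).resolve_right hlm
      · exact fun h => absurd (mem_onLine.2 zm) h
  | zero => exact ⟨0, fun l => by simp⟩
  | add v w _ _ hv hw =>
    obtain ⟨α, hα⟩ := hv
    obtain ⟨β, hβ⟩ := hw
    exact ⟨α + β, fun l => by simp [sum_add_distrib, hα l, hβ l]⟩
  | smul r v _ hv =>
    obtain ⟨α, hα⟩ := hv
    exact ⟨r * α, fun l => by simp [← mul_sum, hα l]⟩

/-- A word vanishing at a point is spanned by lines avoiding that point. -/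
theorem mem_span_of_apply_eq_zero (hR : (order X Λ : R) = 0) {c : X → R}
    (hc : c ∈ Submodule.span R (Set.range (lineVec R : Λ → X → R))) {x : X} (hx : c x = 0) :
    c ∈ Submodule.span R (lineVec R '' {l : Λ | x ∉ l}) := by
  suffices h : c - c x • (1 : X → R) ∈ Submodule.span R (lineVec R '' {l : Λ | x ∉ l}) by
    rwa [hx, zero_smul, sub_zero] at h
  clear hx
  induction hc using Submodule.span_induction with
  | mem v hv =>
    obtain ⟨l, rfl⟩ := hv
    by_cases hl : x ∈ l
    · obtain ⟨z, hz, hzx⟩ := exists_mem_line_notMem X l {x} (by simp)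
      rw [mem_singleton] at hzx
      have h1 : lineVec R l x = 1 := if_pos hl
      rw [h1, one_smul, ← sum_thru_lineVec hR z,
        ← add_sum_erase (thru Λ z) _ (mem_thru.2 hz), sub_add_cancel_left]
      refine Submodule.neg_mem _
        (Submodule.sum_mem _ fun m hm => Submodule.subset_span ⟨m, ?_, rfl⟩)
      rw [mem_erase, mem_thru] at hm
      exact fun hxm => hzx ((eq_or_eq hm.2 hxm hz hl).resolve_right hm.1)
    · have h1 : lineVec R l x = 0 := if_neg hl
      rw [h1, zero_smul, sub_zero]
      exact Submodule.subset_span ⟨l, hl, rfl⟩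
  | zero => simp
  | add v w _ _ hv hw =>
    convert Submodule.add_mem _ hv hw using 1
    rw [Pi.add_apply, add_smul]
    abel
  | smul r v _ hv =>
    convert Submodule.smul_mem _ r hv using 1
    rw [Pi.smul_apply, smul_assoc, smul_sub]

/-- Coordinates in which the lines avoiding `x` are graphs of affine functions on the pencil
of lines through `x` yield a lower bound for the weight of a word vanishing at `x`. -/
theorem pencil_bound_of_coordinates {K : Type*} [Field K] (φ : R →+* K)
    (hφ : Function.Injective φ) {x : X} (t ξ : X → K)
    (ht : ∀ l : Λ, x ∈ l → ∀ y z, y ∈ l → z ∈ l → y ≠ x → z ≠ x → t y = t z)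
    (ht' : ∀ y z, y ≠ x → z ≠ x → t y = t z → ∃ l : Λ, x ∈ l ∧ y ∈ l ∧ z ∈ l)
    (hξ : ∀ l : Λ, x ∈ l → ∀ y z, y ∈ l → z ∈ l → y ≠ x → z ≠ x → ξ y = ξ z → y = z)
    (hf : ∀ l : Λ, x ∉ l → ∃ f : K[X], f.natDegree ≤ 1 ∧ ∀ y, y ∈ l → ξ y = f.eval (t y))
    {c : X → R} (hx : c x = 0) (hc : c ∈ Submodule.span R (lineVec R '' {l : Λ | x ∉ l}))
    {l : Λ} (hl : x ∈ l) :
    (order X Λ + 2) * secantSize c l ≤ #{y | c y ≠ 0} + secantSize c l * secantSize c l := by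
  choose P hPl hPx using fun l : Λ => exists_mem_line_notMem X l {x} (by simp)
  simp only [mem_singleton] at hPx
  have hmom : ∀ j : ℕ, ∃ f : K[X], f.natDegree ≤ j ∧ ∀ m ∈ thru Λ x,
      f.eval (t (P m)) = ∑ y ∈ (onLine X m).erase x, ξ y ^ j * φ (c y) := by
    intro j
    clear hx
    induction hc using Submodule.span_induction with
    | mem v hv =>
      obtain ⟨k, hk, rfl⟩ := hv
      obtain ⟨f, hfd, hfe⟩ := hf k hk
      refine ⟨f ^ j, natDegree_pow_le.trans (by nlinarith), fun m hm => ?_⟩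
      rw [mem_thru] at hm
      have hkm : k ≠ m := fun h => hk (h ▸ hm)
      obtain ⟨zk, zm⟩ := mkPoint_ax (P := X) hkm
      have hzx : (mkPoint hkm : X) ≠ x := fun h => hk (h ▸ zk)
      rw [sum_eq_single (mkPoint hkm : X)]
      · have h1 : lineVec R k (mkPoint hkm : X) = 1 := if_pos zk
        rw [h1, map_one, mul_one, hfe _ zk, eval_pow,
          ht m hm _ _ (hPl m) zm (hPx m) hzx]
      · intro y hy hne
        rw [mem_erase, mem_onLine] at hy
        have h1 : lineVec R k y = 0 := if_neg fun hyk =>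
          hne ((eq_or_eq hyk zk hy.2 zm).resolve_right hkm)
        rw [h1, map_zero, mul_zero]
      · exact fun h => absurd (mem_erase.2 ⟨hzx, mem_onLine.2 zm⟩) h
    | zero => exact ⟨0, by simp, fun m _ => by simp⟩
    | add v w _ _ hv hw =>
      obtain ⟨f, hfd, hfe⟩ := hv
      obtain ⟨g, hgd, hge⟩ := hw
      refine ⟨f + g, natDegree_add_le_of_degree_le hfd hgd, fun m hm => ?_⟩
      rw [eval_add, hfe m hm, hge m hm, ← sum_add_distrib]
      refine sum_congr rfl fun y _ => ?_
      rw [Pi.add_apply, map_add, mul_add]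
    | smul r v _ hv =>
      obtain ⟨f, hfd, hfe⟩ := hv
      refine ⟨C (φ r) * f, (natDegree_C_mul_le _ _).trans hfd, fun m hm => ?_⟩
      rw [eval_mul, eval_C, hfe m hm, mul_sum]
      refine sum_congr rfl fun y _ => ?_
      rw [Pi.smul_apply, smul_eq_mul, map_mul]
      ring
  have hne : ∀ y, c y ≠ 0 → y ≠ x := fun y hy h => hy (h ▸ hx)
  have h1 := sum_fibre_deficit_le (thru Λ x) (fun m => t (P m)) (fun m hm k hk h => by
      obtain ⟨r, hr, hr1, hr2⟩ := ht' _ _ (hPx m) (hPx k) h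
      have e1 := (eq_or_eq (hPl m) (mem_thru.1 hm) hr1 hr).resolve_left (hPx m)
      have e2 := (eq_or_eq (hPl k) (mem_thru.1 hk) hr2 hr).resolve_left (hPx k)
      rw [e1, e2]) (fun m => {y ∈ onLine X m | c y ≠ 0}) ξ (fun y => φ (c y))
    (fun m hm y hy z hz h => by
      simp only [coe_filter, mem_onLine, Set.mem_ofPred_eq] at hy hz
      exact hξ m (mem_thru.1 hm) y z hy.1 hz.1 (hne _ hy.2) (hne _ hz.2) h)
    (fun m _ y hy h => (mem_filter.1 hy).2 (hφ (h.trans (map_zero φ).symm)))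
    (fun j => by
      obtain ⟨f, hfd, hfe⟩ := hmom j
      refine ⟨f, hfd, fun m hm => ?_⟩
      rw [hfe m hm]
      refine (sum_subset (fun y hy => ?_) fun y hy hy' => ?_).symm
      · rw [mem_filter] at hy
        exact mem_erase.2 ⟨hne _ hy.2, hy.1⟩
      · have : c y = 0 := by
          by_contra h
          exact hy' (mem_filter.2 ⟨(mem_erase.1 hy).2, h⟩)
        rw [this, map_zero, mul_zero]) (mem_thru.2 hl)
  change ∑ m ∈ thru Λ x, (secantSize c l - secantSize c m) ≤
    secantSize c l * (secantSize c l - 1) at h1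
  have h2 : ∑ m ∈ thru Λ x, secantSize c l ≤
      ∑ m ∈ thru Λ x, ((secantSize c l - secantSize c m) + secantSize c m) :=
    sum_le_sum fun m _ => by omega
  rw [sum_add_distrib, sum_secantSize, sum_const, card_thru, if_neg (not_not.2 hx), mul_zero,
    add_zero, smul_eq_mul] at h2
  rcases Nat.eq_zero_or_pos (secantSize c l) with h0 | h0
  · simp [h0]
  · obtain ⟨k, hk⟩ := Nat.exists_eq_add_of_le h0
    rw [hk] at h1 h2 ⊢
    rw [Nat.add_sub_cancel_left] at h1
    nlinarith

end LineSpan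

/-! ### The Desarguesian plane -/

section Desarguesian

open scoped LinearAlgebra.Projectivization
open Finset Configuration Polynomial Matrix
open Configuration.ProjectivePlane (order one_lt_order)
open Configuration.Nondegenerate (eq_or_eq)
open Configuration.HasLines (mkLine mkLine_ax)

theorem mk_mem_iff_dotProduct {v : Fin 3 → F} (hv : v ≠ 0) {l : ℙ F (Fin 3 → F)} :
    mk F v hv ∈ l ↔ v ⬝ᵥ l.rep = 0 := by
  rw [ofField.mem_iff, ← orthogonal_mk hv l.rep_nonzero, mk_rep]

theorem mem_iff_dotProduct {x l : ℙ F (Fin 3 → F)} : x ∈ l ↔ x.rep ⬝ᵥ l.rep = 0 := by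
  rw [← mk_mem_iff_dotProduct x.rep_nonzero, mk_rep]

theorem exists_dual_frame {v : Fin 3 → F} (hv : v ≠ 0) : ∃ α β φ : Fin 3 → F,
    α ⬝ᵥ v = 0 ∧ β ⬝ᵥ v = 0 ∧ φ ⬝ᵥ v = 1 ∧
    (∀ w, w ⬝ᵥ v = 0 → ∃ a b : F, w = a • α + b • β) ∧
    ∀ u, α ⬝ᵥ u = 0 → β ⬝ᵥ u = 0 → ∃ r : F, u = r • v := by
  have hd : ∀ u w : Fin 3 → F, u ⬝ᵥ w = u 0 * w 0 + u 1 * w 1 + u 2 * w 2 := fun u w => by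
    rw [dotProduct, Fin.sum_univ_three]
  simp only [hd]
  by_cases h0 : v 0 = 0
  · by_cases h1 : v 1 = 0
    · have h2 : v 2 ≠ 0 := fun h2 => hv (by ext i; fin_cases i <;> assumption)
      refine ⟨![1, 0, 0], ![0, 1, 0], ![0, 0, (v 2)⁻¹], by simp [h0], by simp [h1], by simp [h2],
        fun w hw => ⟨w 0, w 1, ?_⟩, fun u hu hu' => ⟨u 2 / v 2, ?_⟩⟩
      · simp [h0, h1, h2] at hw
        funext i; fin_cases i <;> simp [hw]
      · simp at hu hu'
        funext i; fin_cases i <;> simp [h0, h1, h2, hu, hu']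
    · refine ⟨![1, 0, 0], ![0, v 2, - v 1], ![0, (v 1)⁻¹, 0], by simp [h0], by simp; ring,
        by simp [h1], fun w hw => ⟨w 0, - w 2 / v 1, ?_⟩, fun u hu hu' => ⟨u 1 / v 1, ?_⟩⟩
      · simp [h0] at hw
        funext i; fin_cases i <;> simp [h1]
        field_simp
        linear_combination hw
      · simp at hu hu'
        funext i; fin_cases i <;> simp [h0, h1, hu]
        field_simp
        linear_combination -hu'
  · refine ⟨![v 1, - v 0, 0], ![v 2, 0, - v 0], ![(v 0)⁻¹, 0, 0], by simp; ring, by simp; ring,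
      by simp [h0], fun w hw => ⟨- w 1 / v 0, - w 2 / v 0, ?_⟩, fun u hu hu' => ⟨u 0 / v 0, ?_⟩⟩
    · funext i; fin_cases i <;> simp [h0]
      field_simp
      linear_combination hw
    · simp at hu hu'
      funext i; fin_cases i <;> simp [h0]
      · field_simp
        linear_combination -hu
      · field_simp
        linear_combination -hu'

theorem sum_smul_ne_zero {b : Fin 3 → Fin 3 → F} (hb : LinearIndependent F b) {s : Fin 3 → F}
    (hs : s ≠ 0) : ∑ i, s i • b i ≠ 0 := fun h =>
  hs (funext fun i => Fintype.linearIndependent_iff.1 hb s h i)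

variable [Fintype F]

theorem order_eq_card [Fintype (ℙ F (Fin 3 → F))] :
    order (ℙ F (Fin 3 → F)) (ℙ F (Fin 3 → F)) = Fintype.card F := by
  have h1 := ProjectivePlane.card_points (ℙ F (Fin 3 → F)) (ℙ F (Fin 3 → F))
  have h2 := Projectivization.card_of_finrank F (Fin 3 → F) (n := 3) (by simp)
  rw [Nat.card_eq_fintype_card, h1, Nat.card_eq_fintype_card, sum_range_succ, sum_range_succ,
    sum_range_one] at h2
  generalize order (ℙ F (Fin 3 → F)) (ℙ F (Fin 3 → F)) = a at *
  nlinarith [lt_trichotomy a (Fintype.card F)]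

theorem pencilBound_of_mem_span [Fintype (ℙ F (Fin 3 → F))] {p : ℕ} [Fact p.Prime] [CharP F p]
    {c : ℙ F (Fin 3 → F) → ZMod p}
    (hc : c ∈ Submodule.span (ZMod p)
      (Set.range (lineVec (ZMod p) : ℙ F (Fin 3 → F) → ℙ F (Fin 3 → F) → ZMod p))) :
    PencilBound (ℙ F (Fin 3 → F)) c := by
  have hord : (order (ℙ F (Fin 3 → F)) (ℙ F (Fin 3 → F)) : ZMod p) = 0 := by
    rw [order_eq_card, ZMod.natCast_eq_zero_iff]
    exact (CharP.cast_eq_zero_iff F p _).1 (Nat.cast_card_eq_zero F)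
  intro x hx l hl
  obtain ⟨α, β, φ, hα, hβ, hφ, hw, hv⟩ := exists_dual_frame x.rep_nonzero
  set ι := algebraMap F (AlgebraicClosure F)
  have hι : Function.Injective ι := ι.injective
  obtain ⟨θ, hθ⟩ : ∃ θ, θ ∉ Set.range ι := (Set.finite_range ι).exists_notMem
  have hlin : ∀ a b : F, ι a + θ * ι b = 0 → a = 0 ∧ b = 0 := by
    intro a b h
    have hb : b = 0 := by
      by_contra hb
      refine hθ ⟨-a / b, ?_⟩
      have : ι b ≠ 0 := fun h => hb (hι (h.trans ι.map_zero.symm))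
      rw [map_div₀, map_neg]
      field_simp
      linear_combination -h
    refine ⟨?_, hb⟩
    rw [hb, map_zero, mul_zero, add_zero] at h
    exact hι (h.trans ι.map_zero.symm)
  have hθ0 : θ ≠ 0 := fun h => hθ ⟨0, by rw [h, map_zero]⟩
  set A : ℙ F (Fin 3 → F) → F := fun y => α ⬝ᵥ y.rep with hA
  set B : ℙ F (Fin 3 → F) → F := fun y => β ⬝ᵥ y.rep with hB
  set P : ℙ F (Fin 3 → F) → F := fun y => φ ⬝ᵥ y.rep with hP
  have hAB : ∀ y, y ≠ x → A y = 0 → B y ≠ 0 := by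
    intro y hy h1 h2
    obtain ⟨r, hr⟩ := hv _ h1 h2
    refine hy ?_
    rw [← mk_rep y, ← mk_rep x, mk_eq_mk_iff']
    exact ⟨r, hr.symm⟩
  have hτ : ∀ y, y ≠ x → ι (A y) + θ * ι (B y) ≠ 0 := fun y hy h =>
    hAB y hy (hlin _ _ h).1 (hlin _ _ h).2
  have hcross : ∀ m : ℙ F (Fin 3 → F), x ∈ m → ∀ y z, y ∈ m → z ∈ m → A y * B z = A z * B y := by
    intro m hm y z hy hz
    rw [mem_iff_dotProduct, dotProduct_comm] at hm hy hz
    obtain ⟨a, b, hab⟩ := hw _ hm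
    have hne : ¬ (a = 0 ∧ b = 0) := by
      rintro ⟨rfl, rfl⟩
      exact m.rep_nonzero (by rw [hab]; simp)
    rw [hab, add_dotProduct, smul_dotProduct, smul_dotProduct, smul_eq_mul, smul_eq_mul] at hy hz
    change a * A y + b * B y = 0 at hy
    change a * A z + b * B z = 0 at hz
    rcases eq_or_ne a 0 with ha | ha
    · have hb : b ≠ 0 := fun hb => hne ⟨ha, hb⟩
      refine mul_left_cancel₀ hb ?_
      linear_combination A y * hz - A z * hy
    · refine mul_left_cancel₀ ha ?_
      linear_combination B z * hy - B y * hz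
  have hAy : ∀ y, y ≠ x → A y ≠ 0 ∨ B y ≠ 0 := fun y hy => by
    by_cases h : A y = 0
    exacts [Or.inr (hAB y hy h), Or.inl h]
  refine pencil_bound_of_coordinates (ι.comp (ZMod.castHom (dvd_refl p) F))
    (RingHom.injective _) (fun y => ι (A y) / (ι (A y) + θ * ι (B y)))
    (fun y => ι (P y) / (ι (A y) + θ * ι (B y))) ?_ ?_ ?_ ?_ hx
    (mem_span_of_apply_eq_zero hord hc hx) hl
  · intro m hm y z hy hz hyx hzx
    have h1 := congrArg ι (hcross m hm y z hy hz)
    rw [map_mul, map_mul] at h1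
    rw [div_eq_div_iff (hτ y hyx) (hτ z hzx)]
    linear_combination θ * h1
  · intro y z hyx hzx h
    rw [div_eq_div_iff (hτ y hyx) (hτ z hzx)] at h
    have h1 : A y * B z = A z * B y := by
      refine hι (mul_left_cancel₀ hθ0 ?_)
      rw [map_mul, map_mul]
      linear_combination h
    obtain ⟨hm, hym⟩ := mkLine_ax (L := ℙ F (Fin 3 → F)) hyx.symm
    set m : ℙ F (Fin 3 → F) := mkLine hyx.symm
    refine ⟨m, hm, hym, ?_⟩
    rw [mem_iff_dotProduct, dotProduct_comm] at hm hym ⊢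
    obtain ⟨a, b, hab⟩ := hw _ hm
    rw [hab, add_dotProduct, smul_dotProduct, smul_dotProduct, smul_eq_mul, smul_eq_mul] at hym ⊢
    change a * A y + b * B y = 0 at hym
    change a * A z + b * B z = 0
    rcases hAy y hyx with h2 | h2
    · refine mul_left_cancel₀ h2 ?_
      linear_combination A z * hym + b * h1
    · refine mul_left_cancel₀ h2 ?_
      linear_combination B z * hym - a * h1
  · intro m hm y z hy hz hyx hzx h
    rw [div_eq_div_iff (hτ y hyx) (hτ z hzx)] at h
    have h1 := hcross m hm y z hy hz
    obtain ⟨h2, h3⟩ := hlin (P y * A z - P z * A y) (P y * B z - P z * B y) (by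
      simp only [map_sub, map_mul]
      linear_combination h)
    have key : ∀ a b : F, a ≠ 0 → a * A z = b * A y → a * B z = b * B y → a * P z = b * P y →
        y = z := by
      intro a b ha e1 e2 e3
      obtain ⟨r, hr⟩ := hv (a • z.rep - b • y.rep)
        (by simp only [dotProduct_sub, dotProduct_smul, smul_eq_mul]; exact sub_eq_zero.2 e1)
        (by simp only [dotProduct_sub, dotProduct_smul, smul_eq_mul]; exact sub_eq_zero.2 e2)
      have h5 := congrArg (φ ⬝ᵥ ·) hr
      simp only [dotProduct_sub, dotProduct_smul, smul_eq_mul, hφ, mul_one] at h5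
      have h6 : r = 0 := h5.symm.trans (sub_eq_zero.2 e3)
      rw [h6, zero_smul, sub_eq_zero] at hr
      rw [← mk_rep y, ← mk_rep z, eq_comm, mk_eq_mk_iff']
      exact ⟨a⁻¹ * b, by rw [mul_smul, ← hr, inv_smul_smul₀ ha]⟩
    rcases hAy y hyx with h4 | h4
    · exact key (A y) (A z) h4 (mul_comm _ _) (by linear_combination h1)
        (by linear_combination -h2)
    · exact key (B y) (B z) h4 (by linear_combination -h1) (mul_comm _ _)
        (by linear_combination -h3)
  · intro m hm
    rw [mem_iff_dotProduct, dotProduct_comm] at hm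
    set d := m.rep ⬝ᵥ x.rep
    obtain ⟨a, b, hab⟩ := hw (m.rep - d • φ) (by
      rw [sub_dotProduct, smul_dotProduct, hφ, smul_eq_mul, mul_one, sub_self])
    rw [sub_eq_iff_eq_add] at hab
    refine ⟨C (ι (-a / d)) * X + C (ι (-b / d) / θ) * (1 - X), by compute_degree, fun y hy => ?_⟩
    have hyx : y ≠ x := by
      rintro rfl
      rw [mem_iff_dotProduct, dotProduct_comm] at hy
      exact hm hy
    rw [mem_iff_dotProduct, dotProduct_comm, hab, add_dotProduct, add_dotProduct, smul_dotProduct,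
      smul_dotProduct, smul_dotProduct, smul_eq_mul, smul_eq_mul, smul_eq_mul] at hy
    change a * A y + b * B y + d * P y = 0 at hy
    have hy' := congrArg ι hy
    simp only [map_add, map_mul, map_zero] at hy'
    have hd : ι d ≠ 0 := fun h => hm (hι (h.trans ι.map_zero.symm))
    simp only [eval_add, eval_mul, eval_C, eval_X, eval_sub, eval_one, map_div₀, map_neg]
    have h := hτ y hyx
    field_simp
    linear_combination θ * hy'

/-- The shape of a word with constant line sum whose support is covered by three concurrent
lines. -/
theorem exists_coordinates_of_concurrent [Fintype (ℙ F (Fin 3 → F))] {R : Type*} [AddCommGroup R]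
    {c : ℙ F (Fin 3 → F) → R} {α : R} (hc : LineSum (ℙ F (Fin 3 → F)) c α)
    (hF : 2 < Fintype.card F) {x l m k : ℙ F (Fin 3 → F)} (hlm : l ≠ m) (hlk : l ≠ k) (hmk : m ≠ k)
    (xl : x ∈ l) (xm : x ∈ m) (xk : x ∈ k) (hcov : ∀ y, c y ≠ 0 → y ∈ l ∨ y ∈ m ∨ y ∈ k) :
    ∃ b : Fin 3 → Fin 3 → F, LinearIndependent F b ∧ ∃ (A : F →+ R) (u v : R),
      ∀ (s : Fin 3 → F) (hs : ∑ i, s i • b i ≠ 0),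
        (mk F _ hs ∈ l ↔ s 0 = 0) ∧ (mk F _ hs ∈ m ↔ s 1 = 0) ∧ (mk F _ hs ∈ k ↔ s 0 = s 1) ∧
        (s 0 = 0 → s 1 ≠ 0 → c (mk F _ hs) = u + A (s 2 / s 1)) ∧
        (s 1 = 0 → s 0 ≠ 0 → c (mk F _ hs) = v + A (s 2 / s 0)) ∧
        (s 0 = s 1 → s 0 ≠ 0 → c (mk F _ hs) = α - u - v - A (s 2 / s 0)) ∧
        (s 0 = 0 → s 1 = 0 → c (mk F _ hs) = α) := by
  have U : ∀ {r s y z : ℙ F (Fin 3 → F)}, r ≠ s → y ∈ r → y ∈ s → z ∈ r → z ∈ s → y = z :=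
    fun hrs h1 h2 h3 h4 => (eq_or_eq h1 h3 h2 h4).resolve_right hrs
  obtain ⟨y, hy, hyx⟩ := exists_mem_line_notMem (ℙ F (Fin 3 → F)) l {x} (by simp)
  obtain ⟨z, hz, hzx⟩ := exists_mem_line_notMem (ℙ F (Fin 3 → F)) m {x} (by simp)
  rw [mem_singleton] at hyx hzx
  have hym : y ∉ m := fun h => hyx (U hlm hy h xl xm)
  have hyk : y ∉ k := fun h => hyx (U hlk hy h xl xk)
  have hzl : z ∉ l := fun h => hzx (U hlm h hz xl xm)
  have hzk : z ∉ k := fun h => hzx (U hmk hz h xm xk)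
  have hcx : c x = α := by
    obtain ⟨r, hr, hr'⟩ := exists_line_thru_notMem (ℙ F (Fin 3 → F)) x {l, m, k} (by
      rw [order_eq_card]
      exact card_le_three.trans hF)
    simp only [mem_insert, mem_singleton, not_or] at hr'
    rw [← sum_singleton c x]
    refine hc.eq_sum r _ (by simp [hr]) fun w hw hw0 => ?_
    rw [mem_singleton]
    rcases hcov w hw0 with h | h | h
    exacts [U hr'.1 hw h hr xl, U hr'.2.1 hw h hr xm, U hr'.2.2 hw h hr xk]
  rw [mem_iff_dotProduct] at xl xm xk hy hz hym hyk hzl hzk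
  set b : Fin 3 → Fin 3 → F :=
    ![-(y.rep ⬝ᵥ k.rep) • z.rep, (z.rep ⬝ᵥ k.rep) • y.rep, x.rep] with hbdef
  have hdot : ∀ (s w : Fin 3 → F), (∑ i, s i • b i) ⬝ᵥ w =
      s 0 * (-(y.rep ⬝ᵥ k.rep) * (z.rep ⬝ᵥ w)) + s 1 * ((z.rep ⬝ᵥ k.rep) * (y.rep ⬝ᵥ w)) +
        s 2 * (x.rep ⬝ᵥ w) := by
    intro s w
    simp [Fin.sum_univ_three, hbdef, add_dotProduct, smul_dotProduct]
  have hl : ∀ s : Fin 3 → F, (∑ i, s i • b i) ⬝ᵥ l.rep = 0 ↔ s 0 = 0 := fun s => by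
    simp [hdot, xl, hy, hyk, hzl]
  have hm : ∀ s : Fin 3 → F, (∑ i, s i • b i) ⬝ᵥ m.rep = 0 ↔ s 1 = 0 := fun s => by
    simp [hdot, xm, hz, hzk, hym]
  have hk : ∀ s : Fin 3 → F, (∑ i, s i • b i) ⬝ᵥ k.rep = 0 ↔ s 0 = s 1 := fun s => by
    rw [hdot, xk, show s 0 * (-(y.rep ⬝ᵥ k.rep) * (z.rep ⬝ᵥ k.rep)) +
      s 1 * ((z.rep ⬝ᵥ k.rep) * (y.rep ⬝ᵥ k.rep)) + s 2 * 0 =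
      (s 1 - s 0) * ((y.rep ⬝ᵥ k.rep) * (z.rep ⬝ᵥ k.rep)) by ring, mul_eq_zero,
      or_iff_left (mul_ne_zero hyk hzk), sub_eq_zero, eq_comm]
  have hb : LinearIndependent F b := by
    refine Fintype.linearIndependent_iff.2 fun s hs => ?_
    have h0 := (hl s).1 (by rw [hs, zero_dotProduct])
    have h1 := (hm s).1 (by rw [hs, zero_dotProduct])
    have h2 : s 2 = 0 := by
      rw [Fin.sum_univ_three, h0, h1, zero_smul, zero_smul, zero_add, zero_add] at hs
      exact (smul_eq_zero.1 hs).resolve_right x.rep_nonzero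
    intro i
    fin_cases i
    exacts [h0, h1, h2]
  set c' : (Fin 3 → F) → R := fun v => if h : v ≠ 0 then c (mk F v h) else 0 with hc'
  have hc'mk : ∀ v (hv : v ≠ 0), c' v = c (mk F v hv) := fun v hv => dif_pos hv
  have hc's : ∀ (r : F) v, r ≠ 0 → c' (r • v) = c' v := by
    intro r v hr
    by_cases hv : v = 0
    · rw [hv, smul_zero]
    · rw [hc'mk v hv, hc'mk (r • v) (smul_ne_zero hr hv)]
      congr 1
      exact (mk_eq_mk_iff' F _ _ _ _).2 ⟨r, rfl⟩
  set e : F → F → F → Fin 3 → F := fun a₀ a₁ a₂ => ∑ i, ![a₀, a₁, a₂] i • b i with he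
  have he' : ∀ a₀ a₁ a₂, e a₀ a₁ a₂ = a₀ • b 0 + a₁ • b 1 + a₂ • b 2 := fun _ _ _ =>
    Fin.sum_univ_three _
  have he0 : ∀ a₀ a₁ a₂ : F, (a₀ ≠ 0 ∨ a₁ ≠ 0) → e a₀ a₁ a₂ ≠ 0 := by
    intro a₀ a₁ a₂ h
    refine sum_smul_ne_zero hb fun h0 => ?_
    rcases h with h | h
    exacts [h (congrFun h0 0), h (congrFun h0 1)]
  have hsum : ∀ a d : F, c' (e 0 1 a) + (c' (e 1 0 d) + c' (e 1 1 (a + d))) = α := by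
    intro a d
    have n1 := he0 0 1 a (Or.inr one_ne_zero)
    have n2 := he0 1 0 d (Or.inl one_ne_zero)
    have n3 := he0 1 1 (a + d) (Or.inl one_ne_zero)
    rw [hc'mk _ n1, hc'mk _ n2, hc'mk _ n3]
    have p1l : mk F _ n1 ∈ l := (mk_mem_iff_dotProduct n1).2 ((hl _).2 rfl)
    have p2l : mk F _ n2 ∉ l := fun h => one_ne_zero ((hl _).1 ((mk_mem_iff_dotProduct n2).1 h))
    have p3l : mk F _ n3 ∉ l := fun h => one_ne_zero ((hl _).1 ((mk_mem_iff_dotProduct n3).1 h))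
    have p2m : mk F _ n2 ∈ m := (mk_mem_iff_dotProduct n2).2 ((hm _).2 rfl)
    have p1m : mk F _ n1 ∉ m := fun h => one_ne_zero ((hm _).1 ((mk_mem_iff_dotProduct n1).1 h))
    have p3m : mk F _ n3 ∉ m := fun h => one_ne_zero ((hm _).1 ((mk_mem_iff_dotProduct n3).1 h))
    have p3k : mk F _ n3 ∈ k := (mk_mem_iff_dotProduct n3).2 ((hk _).2 rfl)
    have p1k : mk F _ n1 ∉ k := fun h => zero_ne_one ((hk _).1 ((mk_mem_iff_dotProduct n1).1 h))
    have h12 : mk F _ n1 ≠ mk F _ n2 := fun h => p2l (h ▸ p1l)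
    have h13 : mk F _ n1 ≠ mk F _ n3 := fun h => p3l (h ▸ p1l)
    have h23 : mk F _ n2 ≠ mk F _ n3 := fun h => p3m (h ▸ p2m)
    obtain ⟨r1, r2⟩ := mkLine_ax (L := ℙ F (Fin 3 → F)) h12
    set r : ℙ F (Fin 3 → F) := mkLine h12
    have r3 : mk F _ n3 ∈ r := by
      rw [mk_mem_iff_dotProduct] at r1 r2 ⊢
      have : e 1 1 (a + d) = e 0 1 a + e 1 0 d := by
        simp only [he']
        module
      rw [this, add_dotProduct, r1, r2, add_zero]
    rw [← sum_pair (f := c) h23, ← sum_insert (by simp [h12, h13])]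
    refine hc.eq_sum r _ (by simp [r1, r2, r3]) fun w hw hw0 => ?_
    have rl : r ≠ l := fun h => p2l (h ▸ r2)
    have rm : r ≠ m := fun h => p1m (h ▸ r1)
    have rk : r ≠ k := fun h => p1k (h ▸ r1)
    rcases hcov w hw0 with h | h | h
    · simp [U rl hw h r1 p1l]
    · simp [U rm hw h r2 p2m]
    · simp [U rk hw h r3 p3k]
  have huv : ∀ a, c' (e 1 0 a) - c' (e 1 0 0) = c' (e 0 1 a) - c' (e 0 1 0) := by
    intro a
    have h1 := hsum a 0
    have h2 := hsum 0 a
    rw [add_zero, ← h2, zero_add] at h1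
    rw [← sub_eq_zero] at h1 ⊢
    rw [← neg_eq_zero, ← h1]
    abel
  set A : F →+ R := AddMonoidHom.mk' (fun a => c' (e 0 1 a) - c' (e 0 1 0)) fun a d => by
    have h1 := hsum (a + d) 0
    have h2 := hsum a d
    have h3 := huv d
    rw [add_zero, ← h2] at h1
    rw [← h3]
    rw [← sub_eq_zero] at h1 ⊢
    rw [← h1]
    abel with hA
  refine ⟨b, hb, A, c' (e 0 1 0), c' (e 1 0 0), fun s hs => ⟨?_, ?_, ?_, fun h0 h1 => ?_,
    fun h1 h0 => ?_, fun h01 h0 => ?_, fun h0 h1 => ?_⟩⟩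
  · rw [mk_mem_iff_dotProduct, hl]
  · rw [mk_mem_iff_dotProduct, hm]
  · rw [mk_mem_iff_dotProduct, hk]
  · have h2 : ∑ i, s i • b i = s 1 • e 0 1 (s 2 / s 1) := by
      simp only [he', Fin.sum_univ_three, h0, smul_add,
        smul_smul, mul_div_cancel₀ _ h1, mul_zero, mul_one]
    rw [← hc'mk, h2, hc's _ _ h1]
    exact (add_sub_cancel _ _).symm
  · have h2 : ∑ i, s i • b i = s 0 • e 1 0 (s 2 / s 0) := by
      simp only [he', Fin.sum_univ_three, h1, smul_add,
        smul_smul, mul_div_cancel₀ _ h0, mul_zero, mul_one]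
    rw [← hc'mk, h2, hc's _ _ h0]
    change _ = c' (e 1 0 0) + (c' (e 0 1 _) - c' (e 0 1 0))
    rw [← huv, add_sub_cancel]
  · have h2 : ∑ i, s i • b i = s 0 • e 1 1 (s 2 / s 0) := by
      simp only [he', Fin.sum_univ_three, ← h01, smul_add,
        smul_smul, mul_div_cancel₀ _ h0, mul_one]
    rw [← hc'mk, h2, hc's _ _ h0]
    change _ = α - c' (e 0 1 0) - c' (e 1 0 0) - (c' (e 0 1 _) - c' (e 0 1 0))
    rw [← hsum (s 2 / s 0) 0, add_zero]
    abel
  · rw [← hcx]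
    congr 1
    rw [← mk_rep x, mk_eq_mk_iff']
    refine ⟨s 2, ?_⟩
    rw [Fin.sum_univ_three, h0, h1, zero_smul, zero_smul, zero_add, zero_add]
    rfl

end Desarguesian

/-! ### Lines as subspaces -/

section Subspaces

open scoped LinearAlgebra.Projectivization
open Finset Configuration Matrix
open Configuration.Nondegenerate (eq_or_eq)

/-- The subspace of `F ^ 3` cut out by the homogeneous coordinates of a line. -/
def lineSub (l : ℙ F (Fin 3 → F)) : Submodule F (Fin (2 + 1) → F) :=
  LinearMap.ker (dotProductEquiv F (Fin 3) l.rep)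

theorem ptIn_lineSub {x : Pt F 2} {l : ℙ F (Fin 3 → F)} :
    ptIn x (lineSub l) ↔ (show ℙ F (Fin 3 → F) from x) ∈ l := by
  rw [ptIn, Projectivization.submodule_eq, Submodule.span_singleton_le_iff_mem, lineSub,
    LinearMap.mem_ker, mem_iff_dotProduct, dotProduct_comm]
  rfl

theorem isLine_lineSub (l : ℙ F (Fin 3 → F)) : IsLine (lineSub l) := by
  have h := Module.Dual.finrank_ker_add_one_of_ne_zero (f := dotProductEquiv F (Fin 3) l.rep)
    ((dotProductEquiv F (Fin 3)).map_ne_zero_iff.2 l.rep_nonzero)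
  rw [Module.finrank_fin_fun] at h
  exact Nat.succ_injective h

theorem exists_eq_lineSub {W : Submodule F (Fin (2 + 1) → F)} (hW : IsLine W) :
    ∃ l, W = lineSub l := by
  have hW' : Module.finrank F W = 2 := hW
  have hlt : W < ⊤ := lt_top_iff_ne_top.2 fun h => by
    rw [h, finrank_top, Module.finrank_fin_fun] at hW'
    omega
  obtain ⟨f, hf, hWf⟩ := Submodule.exists_le_ker_of_lt_top W hlt
  have hv : (dotProductEquiv F (Fin 3)).symm f ≠ 0 :=
    (dotProductEquiv F (Fin 3)).symm.map_ne_zero_iff.2 hf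
  refine ⟨mk F _ hv, ?_⟩
  obtain ⟨a, ha⟩ := exists_smul_eq_mk_rep F _ hv
  refine Submodule.eq_of_le_of_finrank_eq (fun w hw => ?_) (hW'.trans (isLine_lineSub _).symm)
  rw [lineSub, LinearMap.mem_ker, ← ha, Units.smul_def, map_smul, LinearEquiv.apply_symm_apply,
    LinearMap.smul_apply, LinearMap.mem_ker.1 (hWf hw), smul_zero]

theorem incVec_lineSub (p : ℕ) (l : ℙ F (Fin 3 → F)) :
    incVec p (lineSub l) = lineVec (ZMod p) l := by
  funext x
  exact if_congr ptIn_lineSub rfl rfl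

theorem code_le_span_lineVec (p : ℕ) : code F p 2 ≤ Submodule.span (ZMod p)
    (Set.range (lineVec (ZMod p) : ℙ F (Fin 3 → F) → ℙ F (Fin 3 → F) → ZMod p)) := by
  refine Submodule.span_mono ?_
  rintro v ⟨W, hW, rfl⟩
  obtain ⟨l, rfl⟩ := exists_eq_lineSub hW
  exact ⟨l, (incVec_lineSub p l).symm⟩

/-- A combination of lines of the projective plane is one of two-dimensional subspaces. -/
theorem exists_sum_incVec {p : ℕ} [Fintype F] {c : Pt F 2 → ZMod p} {ι : Type*} (T : Finset ι)
    (l : ι → ℙ F (Fin 3 → F)) (a : ι → ZMod p) (hc : c = ∑ i ∈ T, a i • lineVec (ZMod p) (l i)) :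
    ∃ (s : Finset (Submodule F (Fin (2 + 1) → F))) (a : Submodule F (Fin (2 + 1) → F) → ZMod p),
      s.card ≤ #T ∧ (∀ l ∈ s, IsLine l) ∧ c = ∑ l ∈ s, a l • incVec p l := by
  refine ⟨T.image (lineSub ∘ l), fun W => ∑ i ∈ T with lineSub (l i) = W, a i,
    card_image_le, ?_, ?_⟩
  · simp only [mem_image]
    rintro _ ⟨i, _, rfl⟩
    exact isLine_lineSub _
  · rw [hc, ← sum_fiberwise_of_maps_to (g := lineSub ∘ l) (fun i hi => mem_image_of_mem _ hi)]
    refine sum_congr rfl fun W _ => ?_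
    rw [sum_smul]
    refine sum_congr rfl fun i hi => ?_
    rw [← (mem_filter.1 hi).2, ← incVec_lineSub]

end Subspaces

/-! ### Words covered by three lines -/

section Concurrent


open scoped LinearAlgebra.Projectivization
open Finset Configuration Matrix
open Configuration.ProjectivePlane (order)

section

variable {X Λ : Type*} [Membership X Λ] [Fintype X] {R ι : Type*} [Zero R] {c : X → R} {l : Λ}
  {T : Finset ι} {P : ι → X}

theorem card_le_secantSize (hP : Set.InjOn P T) (h : ∀ i ∈ T, P i ∈ l ∧ c (P i) ≠ 0) :
    #T ≤ secantSize c l :=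
  card_le_card_of_injOn P (fun i hi => mem_filter.2 ⟨mem_onLine.2 (h i hi).1, (h i hi).2⟩) hP

theorem secantSize_add_card_le [Fintype Λ] [ProjectivePlane X Λ] (hP : Set.InjOn P T)
    (h : ∀ i ∈ T, P i ∈ l ∧ c (P i) = 0) : secantSize c l + #T ≤ order X Λ + 1 := by
  rw [← card_onLine X l, ← card_filter_add_card_filter_not (s := onLine X l) (fun x => c x ≠ 0)]
  exact Nat.add_le_add_left (card_le_card_of_injOn P
    (fun i hi => mem_filter.2 ⟨mem_onLine.2 (h i hi).1, not_not.2 (h i hi).2⟩) hP) _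

end

/-- The normal form of a word with constant line sum whose support is covered by three concurrent
lines. -/
theorem exists_normal_form_of_concurrent [Fintype F] [Fintype (ℙ F (Fin 3 → F))] {R : Type*}
    [AddCommGroup R] {c : ℙ F (Fin 3 → F) → R} {α : R} (hc : LineSum (ℙ F (Fin 3 → F)) c α)
    (hF : 2 < Fintype.card F) {x l m k : ℙ F (Fin 3 → F)} (hlm : l ≠ m) (hlk : l ≠ k) (hmk : m ≠ k)
    (xl : x ∈ l) (xm : x ∈ m) (xk : x ∈ k) (hcov : ∀ y, c y ≠ 0 → y ∈ l ∨ y ∈ m ∨ y ∈ k) :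
    ∃ b : Fin 3 → Fin 3 → F, LinearIndependent F b ∧ ∃ (A : F →+ R) (u v w : R),
      ∀ (s : Fin 3 → F) (hs : ∑ i, s i • b i ≠ 0),
        (mk F _ hs ∈ l ↔ s 0 = 0) ∧ (mk F _ hs ∈ m ↔ s 1 = 0) ∧ (mk F _ hs ∈ k ↔ s 0 = s 1) ∧
        c (mk F _ hs) =
          (if s 0 = 0 ∧ s 1 ≠ 0 then A (s 2 / s 1)
            else if s 1 = 0 ∧ s 0 ≠ 0 then A (s 2 / s 0)
            else if s 0 = s 1 ∧ s 0 ≠ 0 then -A (s 2 / s 0) else 0) +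
          (if s 0 = 0 then u else 0) + (if s 1 = 0 then v else 0) +
          (if s 0 = s 1 then w else 0) := by
  obtain ⟨b, hb, A, u, v, H⟩ := exists_coordinates_of_concurrent hc hF hlm hlk hmk xl xm xk hcov
  refine ⟨b, hb, A, u, v, α - u - v, fun s hs => ?_⟩
  obtain ⟨hl, hm, hk, h1, h2, h3, h4⟩ := H s hs
  refine ⟨hl, hm, hk, ?_⟩
  by_cases s0 : s 0 = 0
  · by_cases s1 : s 1 = 0
    · rw [h4 s0 s1]
      simp [s0, s1]
    · rw [h1 s0 s1]
      simp [s0, s1, Ne.symm s1, add_comm]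
  · by_cases s1 : s 1 = 0
    · rw [h2 s1 s0]
      simp [s0, s1, add_comm]
    · by_cases s01 : s 0 = s 1
      · rw [h3 s01 s0]
        simp [s1, s01]
        abel
      · have h0 : c (mk F _ hs) = 0 := by
          by_contra h
          rcases hcov _ h with h | h | h
          exacts [s0 (hl.1 h), s1 (hm.1 h), s01 (hk.1 h)]
        rw [h0]
        simp [s0, s1, s01]

theorem exists_eq_mk_of_linearIndependent {b : Fin 3 → Fin 3 → F} (hb : LinearIndependent F b)
    (x : ℙ F (Fin 3 → F)) : ∃ (s : Fin 3 → F) (hs : ∑ i, s i • b i ≠ 0), x = mk F _ hs := by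
  have htop := hb.span_eq_top_of_card_eq_finrank (by simp)
  obtain ⟨s, hs⟩ := (Submodule.mem_span_range_iff_exists_fun F).1
    (htop.symm ▸ Submodule.mem_top : x.rep ∈ Submodule.span F (Set.range b))
  refine ⟨s, hs.symm ▸ x.rep_nonzero, ?_⟩
  simp_rw [hs, mk_rep]

theorem card_fibre_mul [Fintype F] {p : ℕ} [Fact p.Prime] {A : F →+ ZMod p} (hA : A ≠ 0)
    (t : ZMod p) : #{a | A a = t} * p = Fintype.card F := by
  obtain ⟨a, ha⟩ : ∃ a, A a ≠ 0 := by
    by_contra! h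
    exact hA (AddMonoidHom.ext h)
  have hsurj : Function.Surjective A := fun t => ⟨(t / A a).val • a, by
    rw [map_nsmul, nsmul_eq_mul, ZMod.natCast_zmod_val, div_mul_cancel₀ _ ha]⟩
  rw [← card_univ (α := F), card_eq_sum_card_fiberwise (s := univ) (f := A) (t := univ)
      (fun _ _ => mem_univ _),
    sum_congr rfl fun t' _ => AddMonoidHom.card_fiber_eq_of_mem_range A (hsurj t') (hsurj t),
    sum_const, card_univ, ZMod.card, smul_eq_mul, mul_comm]

/-- A nonzero additive map can only occur in the normal form over the prime field, as otherwise
the number of zeros on a line is too large. -/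
theorem eq_zero_of_secantSize [Fintype F] [Fintype (ℙ F (Fin 3 → F))] {p h : ℕ} [Fact p.Prime]
    (hF : Fintype.card F = p ^ h) (hh : 2 ≤ h) (hq : 8 < Fintype.card F)
    {c : ℙ F (Fin 3 → F) → ZMod p} {l : ℙ F (Fin 3 → F)}
    (hl : secantSize c l ≤ 3 ∨ Fintype.card F + 1 ≤ secantSize c l + 2)
    {b : Fin 3 → Fin 3 → F} (hb : LinearIndependent F b) {A : F →+ ZMod p} {u : ZMod p}
    (H : ∀ (a : F) (hs : ∑ i, ![0, 1, a] i • b i ≠ 0),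
      mk F _ hs ∈ l ∧ c (mk F _ hs) = u + A a) : A = 0 := by
  by_contra hA
  have hp : 2 ≤ p := (Fact.out : p.Prime).two_le
  have hz := card_fibre_mul hA (-u)
  set Z : Finset F := {a | A a = -u} with hZ
  have hne : ∀ a : F, ∑ i, ![0, 1, a] i • b i ≠ 0 := fun a =>
    sum_smul_ne_zero hb fun h => one_ne_zero (congrFun h 1)
  set P : F → ℙ F (Fin 3 → F) := fun a => mk F _ (hne a) with hP
  have hinj : Function.Injective P := by
    intro a a' haa
    obtain ⟨r, hr⟩ := (mk_eq_mk_iff' F _ _ _ _).1 haa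
    rw [smul_sum, ← sub_eq_zero, ← sum_sub_distrib] at hr
    simp_rw [smul_smul, ← sub_smul] at hr
    have h0 := Fintype.linearIndependent_iff.1 hb (fun i => r * ![0, 1, a'] i - ![0, 1, a] i) hr
    have h1 : r * 1 - 1 = 0 := h0 1
    have h2 : r * a' - a = 0 := h0 2
    linear_combination a' * h1 - h2
  have h1 : #Zᶜ ≤ secantSize c l := by
    refine card_le_secantSize hinj.injOn fun a ha => ⟨(H a (hne a)).1, fun h => ?_⟩
    rw [(H a (hne a)).2, add_comm] at h
    exact mem_compl.1 ha (mem_filter.2 ⟨mem_univ a, eq_neg_of_add_eq_zero_left h⟩)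
  have h2 : secantSize c l + #Z ≤ order (ℙ F (Fin 3 → F)) (ℙ F (Fin 3 → F)) + 1 := by
    refine secantSize_add_card_le hinj.injOn fun a ha => ⟨(H a (hne a)).1, ?_⟩
    rw [(H a (hne a)).2, (mem_filter.1 ha).2, add_neg_cancel]
  rw [order_eq_card] at h2
  rw [card_compl] at h1
  have h4 : 3 ≤ #Z := by
    have h5 : p ^ 2 ≤ p ^ h := Nat.pow_le_pow_right (by omega) hh
    rw [← hF] at h5
    by_contra! h6
    nlinarith
  have h5 : #Z * 2 ≤ Fintype.card F := hz ▸ Nat.mul_le_mul_left _ hp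
  omega

theorem typeOdd_of_normal_form [Fintype F] {p : ℕ} [Fact p.Prime] (hF : Fintype.card F = p)
    {c : Pt F 2 → ZMod p} {b : Fin 3 → Fin (2 + 1) → F} (hb : LinearIndependent F b)
    {A : F →+ ZMod p} (hA : A ≠ 0) {u v w : ZMod p}
    (H : ∀ (s : Fin 3 → F) (hs : ∑ i, s i • b i ≠ 0),
        c (mk F _ hs) =
          (if s 0 = 0 ∧ s 1 ≠ 0 then A (s 2 / s 1)
            else if s 1 = 0 ∧ s 0 ≠ 0 then A (s 2 / s 0)
            else if s 0 = s 1 ∧ s 0 ≠ 0 then -A (s 2 / s 0) else 0) +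
          (if s 0 = 0 then u else 0) + (if s 1 = 0 then v else 0) +
          (if s 0 = s 1 then w else 0)) :
    TypeOdd p c (⊤ : Submodule F (Fin (2 + 1) → F)) := by
  have : CharP F p := charP_of_card_eq_prime_pow (f := 1) (by rw [hF, pow_one])
  set σ : ZMod p →+* F := ZMod.castHom (dvd_refl p) F
  have hσ : Function.Injective σ := σ.injective
  have hsurj : Function.Surjective σ :=
    ((Fintype.bijective_iff_injective_and_card σ).2 ⟨hσ, by rw [ZMod.card, hF]⟩).2
  have hlin : ∀ z, A (σ z) = A 1 * z := fun z => by
    have h := ZMod.map_smul (A.comp σ.toAddMonoidHom) z 1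
    rw [smul_eq_mul, mul_one, smul_eq_mul, mul_comm] at h
    exact h.trans (congrArg (A · * z) σ.map_one)
  refine ⟨hF, σ, b, hb, hb.span_eq_top_of_card_eq_finrank (by simp), LinearEquiv.refl _ _, A 1,
    u, v, w, fun h => hA (AddMonoidHom.ext fun a => ?_), fun Q => ?_⟩
  · obtain ⟨z, rfl⟩ := hsurj a
    rw [hlin, h, zero_mul, AddMonoidHom.zero_apply]
  · have hmap : Projectivization.map (LinearEquiv.refl (ZMod p) (Fin 3 → ZMod p)).toLinearMap
        (LinearEquiv.refl (ZMod p) (Fin 3 → ZMod p)).injective Q = Q :=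
      congrFun Projectivization.map_id Q
    have hpt : ∀ W : Submodule (ZMod p) (Fin 3 → ZMod p), ptIn (n := 2) Q W ↔ Q.rep ∈ W :=
      fun W => by
        rw [ptIn, Projectivization.submodule_eq, Submodule.span_singleton_le_iff_mem]
    rw [oddWord, hmap, planeEmbed, H]
    have i0 : ∀ z, σ z = 0 ↔ z = 0 := fun z => map_eq_zero σ
    simp only [incVec, hpt, lineM1, lineM2, lineM3, LinearMap.mem_ker, LinearMap.proj_apply,
      LinearMap.sub_apply, sub_eq_zero, oddBase, i0, hσ.eq_iff, ← map_div₀, hlin, ne_eq, mul_ite,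
      mul_one, mul_zero, mul_neg]

end Concurrent

/-! ### Classification of words of small weight -/

section Classification

open scoped LinearAlgebra.Projectivization
open Finset Configuration
open Configuration.ProjectivePlane (order)

section

variable {X Λ : Type*} [Membership X Λ]

theorem eq_sum_two {R : Type*} [CommRing R] {c : X → R} {l m : Λ} {a b : R}
    (h : ∀ x, c x = (if x ∈ l then a else 0) + (if x ∈ m then b else 0)) :
    c = ∑ i, ![a, b] i • lineVec R (![l, m] i) := by
  funext x
  rw [h, Fin.sum_univ_two, ← mul_boole (x ∈ l), ← mul_boole (x ∈ m)]
  rfl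

theorem eq_sum_three {R : Type*} [CommRing R] {c : X → R} {l m k : Λ} {a b d : R}
    (h : ∀ x, c x =
      (if x ∈ l then a else 0) + (if x ∈ m then b else 0) + (if x ∈ k then d else 0)) :
    c = ∑ i, ![a, b, d] i • lineVec R (![l, m, k] i) := by
  funext x
  rw [h, Fin.sum_univ_three, ← mul_boole (x ∈ l), ← mul_boole (x ∈ m), ← mul_boole (x ∈ k)]
  rfl

theorem ncard_support {R : Type*} [Fintype X] [Zero R] (c : X → R) :
    {x | c x ≠ 0}.ncard = #{x | c x ≠ 0} := by
  rw [← Set.ncard_coe_finset]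
  congr 1
  ext x
  simp

theorem secantSize_le {R : Type*} [Fintype X] [Zero R] (c : X → R) (l : Λ) :
    secantSize c l ≤ #{x | c x ≠ 0} :=
  card_le_card (filter_subset_filter _ (subset_univ _))

end

variable [Fintype F] {p : ℕ} [Fact p.Prime] [CharP F p]

theorem exists_lineSum_of_mem_code [Fintype (ℙ F (Fin 3 → F))] {c : ℙ F (Fin 3 → F) → ZMod p}
    (hc : c ∈ code F p 2) : ∃ α, LineSum (ℙ F (Fin 3 → F)) c α := by
  refine exists_lineSum_of_mem_span ?_ (code_le_span_lineVec p hc)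
  rw [order_eq_card, ZMod.natCast_eq_zero_iff]
  exact (CharP.cast_eq_zero_iff F p _).1 (Nat.cast_card_eq_zero F)

theorem two_lines_of_wt_le {c : Pt F 2 → ZMod p} (hc : c ∈ code F p 2)
    (hw : wt c ≤ 3 * Fintype.card F - 4) :
    ∃ (s : Finset (Submodule F (Fin (2 + 1) → F))) (a : Submodule F (Fin (2 + 1) → F) → ZMod p),
      s.card ≤ 2 ∧ (∀ l ∈ s, IsLine l) ∧ c = ∑ l ∈ s, a l • incVec p l := by
  have : Fintype (ℙ F (Fin 3 → F)) := Fintype.ofFinite _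
  obtain ⟨α, hα⟩ := exists_lineSum_of_mem_code hc
  have hA := pencilBound_of_mem_span (code_le_span_lineVec p hc)
  have ho := order_eq_card (F := F)
  have h1 := Fintype.one_lt_card (α := F)
  rw [wt, supp, ncard_support] at hw
  obtain h2 | h2 : Fintype.card F = 2 ∨ 2 < Fintype.card F := by omega
  · have h0 : c = 0 := by
      funext x
      by_contra hx
      obtain ⟨l, -, hl⟩ := exists_long_line hα hA 0 (by omega) (hw.trans_lt (by omega)) hx
      have h3 := (secantSize_le c l).trans hw
      omega
    exact ⟨∅, 0, by simp, by simp, by simpa using h0⟩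
  · have hS := hw.trans_lt
      (show _ < (1 + 2) * (order (ℙ F (Fin 3 → F)) (ℙ F (Fin 3 → F)) - 1) by omega)
    have hcard : ∀ n, n ≤ 3 * Fintype.card F - 4 → 2 * n + (1 + 2) * (1 + 1) <
        2 * ((1 + 2) * (order (ℙ F (Fin 3 → F)) (ℙ F (Fin 3 → F)) + 1 - 1)) := by omega
    obtain ⟨T, hT, hcov⟩ := exists_cover (Λ := ℙ F (Fin 3 → F)) (e := 1) (by omega)
      (fun x hx => exists_long_line hα hA 1 (by omega) hS hx) (hcard _ hw)
    obtain ⟨l, m, hlm, rfl⟩ := card_eq_two.1 hT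
    simp only [mem_insert, mem_singleton, exists_eq_or_imp, exists_eq_left] at hcov
    obtain ⟨a, b, h⟩ := eq_two_lines hα hlm hcov
    exact exists_sum_incVec _ _ _ (eq_sum_two h)

/-- A word of small weight is a combination of at most three lines, except possibly over prime
fields. -/
theorem three_lines_or_typeOdd {h : ℕ} (hF : Fintype.card F = p ^ h) (hq : 17 < Fintype.card F)
    {c : Pt F 2 → ZMod p} (hc : c ∈ code F p 2)
    (hw : wt c ≤ max (3 * Fintype.card F + 1) (4 * Fintype.card F - 22)) :
    (∃ (s : Finset (Submodule F (Fin (2 + 1) → F))) (a : Submodule F (Fin (2 + 1) → F) → ZMod p),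
      s.card ≤ 3 ∧ (∀ l ∈ s, IsLine l) ∧ c = ∑ l ∈ s, a l • incVec p l) ∨
    TypeOdd p c (⊤ : Submodule F (Fin (2 + 1) → F)) := by
  have : Fintype (ℙ F (Fin 3 → F)) := Fintype.ofFinite _
  obtain ⟨α, hα⟩ := exists_lineSum_of_mem_code hc
  have hA := pencilBound_of_mem_span (code_le_span_lineVec p hc)
  have ho := order_eq_card (F := F)
  rw [wt, supp, ncard_support] at hw
  have hmax : max (3 * Fintype.card F + 1) (4 * Fintype.card F - 22) < 4 * Fintype.card F - 10 := by
    omega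
  have hw' := hw.trans_lt hmax
  have hmul : 4 * Fintype.card F - 10 ≤
      (2 + 2) * (order (ℙ F (Fin 3 → F)) (ℙ F (Fin 3 → F)) - 2) := by omega
  have hS := hw'.trans_le hmul
  have hcard : ∀ n, n < 4 * Fintype.card F - 10 → 2 * n + (2 + 2) * (2 + 1) <
      2 * ((2 + 2) * (order (ℙ F (Fin 3 → F)) (ℙ F (Fin 3 → F)) + 1 - 2)) := by omega
  obtain ⟨T, hT, hcov⟩ := exists_cover (Λ := ℙ F (Fin 3 → F)) (e := 2) (by omega)
    (fun x hx => exists_long_line hα hA 2 (by omega) hS hx) (hcard _ hw')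
  obtain ⟨l, m, k, hlm, hlk, hmk, rfl⟩ := card_eq_three.1 hT
  simp only [mem_insert, mem_singleton, exists_eq_or_imp, exists_eq_left] at hcov
  by_cases hcon : ∀ x, x ∈ l → x ∈ m → x ∉ k
  · obtain ⟨a, b, d, h⟩ := eq_triangle hα hlm hlk hmk hcon hcov
    exact Or.inl (exists_sum_incVec _ _ _ (eq_sum_three h))
  push Not at hcon
  obtain ⟨x, xl, xm, xk⟩ := hcon
  obtain ⟨b, hb, A, u, v, w, H⟩ :=
    exists_normal_form_of_concurrent hα (by omega) hlm hlk hmk xl xm xk hcov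
  by_cases h0 : A = 0
  · refine Or.inl (exists_sum_incVec _ _ _
      (eq_sum_three (l := l) (m := m) (k := k) (a := u) (b := v) (d := w) fun y => ?_))
    obtain ⟨s, hs, rfl⟩ := exists_eq_mk_of_linearIndependent hb y
    obtain ⟨hl, hm, hk, h⟩ := H s hs
    rw [h, h0]
    simp [hl, hm, hk]
  · obtain hh | hh : h ≤ 1 ∨ 2 ≤ h := by omega
    · right
      refine typeOdd_of_normal_form ?_ hb h0 fun s hs => (H s hs).2.2.2
      rcases Nat.le_one_iff_eq_zero_or_eq_one.1 hh with rfl | rfl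
      · rw [pow_zero] at hF
        omega
      · rw [hF, pow_one]
    · refine absurd (eq_zero_of_secantSize hF hh (by omega) (l := l) (c := c) (u := u) ?_ hb
        fun a hs => ?_) h0
      · have := secantSize_dichotomy hA (e := 2) (by omega) hS l
        rwa [ho] at this
      · obtain ⟨hl, -, -, h⟩ := H _ hs
        refine ⟨hl.2 rfl, h.trans ?_⟩
        simp [add_comm]

end Classification

/-- Corollary 7 of the paper: classification of small weight code words in
the plane code `C_1(2,q)`. -/
theorem statement18 [Fintype F] {p h q : ℕ} [Fact p.Prime] (hh : 1 ≤ h) (hq : q = p ^ h)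
    (hqex : q ∉ ({8, 9, 16, 25, 27, 49} : Set ℕ))
    (hF : Fintype.card F = q)
    (c : Pt F 2 → ZMod p) (hc : c ∈ code F p 2) :
    (wt c ≤ 3 * q - 4 →
      ∃ (s : Finset (Submodule F (Fin (2 + 1) → F)))
        (a : Submodule F (Fin (2 + 1) → F) → ZMod p),
        s.card ≤ 2 ∧ (∀ l ∈ s, IsLine l) ∧ c = ∑ l ∈ s, a l • incVec p l) ∧
    (q = 121 → wt c ≤ 3 * q + 1 →
      ∃ (s : Finset (Submodule F (Fin (2 + 1) → F)))
        (a : Submodule F (Fin (2 + 1) → F) → ZMod p),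
        s.card ≤ 3 ∧ (∀ l ∈ s, IsLine l) ∧ c = ∑ l ∈ s, a l • incVec p l) ∧
    (17 < q → q ≠ 121 → wt c ≤ max (3 * q + 1) (4 * q - 22) →
      (∃ (s : Finset (Submodule F (Fin (2 + 1) → F)))
        (a : Submodule F (Fin (2 + 1) → F) → ZMod p),
        s.card ≤ 3 ∧ (∀ l ∈ s, IsLine l) ∧ c = ∑ l ∈ s, a l • incVec p l) ∨
      TypeOdd p c (⊤ : Submodule F (Fin (2 + 1) → F))) := by
  have hcard : Fintype.card F = p ^ h := hF.trans hq
  have : CharP F p := charP_of_card_eq_prime_pow hcard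
  subst hF
  refine ⟨two_lines_of_wt_le hc, fun h121 hw => ?_, fun h17 _ hw => ?_⟩
  · refine (three_lines_or_typeOdd hcard (by omega) hc
      (hw.trans (le_max_left _ _))).resolve_right ?_
    rintro ⟨hp, -⟩
    have hprime : p.Prime := Fact.out
    rw [← hp, h121] at hprime
    norm_num at hprime
  · exact three_lines_or_typeOdd hcard h17 hc hw

end PGCode
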